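/- arXiv:2512.06856 — 3 statements merged into one kernel-verified Lean document; each statement's English description precedes it below -/
import Mathlib

section
/- Let f : A → B be an embedding of G-algebras over a field k of characteristic p and P a p-subgroup of G. Then the induced map f(P) : A(P) → B(P) on Brauer quotients, defined by f(P)(br_P(a)) = br_P(f(a)), is again an embedding of k-algebras. -/
open scoped BigOperators

noncomputable section

section BrauerMachinery

variable (k : Type*) [Field k] {G : Type*} [Group G]
variable (A : Type*) [Ring A] [Algebra k A] [MulSemiringAction G A] [SMulCommClass G k A]

/-- The `k`-submodule of `P`-fixed points of `A`. -/
def fixedPts (P : Subgroup G) : Submodule k A where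
  carrier := {a | ∀ g ∈ P, g • a = a}
  add_mem' := fun {a b} ha hb g hg => by rw [smul_add, ha g hg, hb g hg]
  zero_mem' := fun g _ => smul_zero g
  smul_mem' := fun c a ha g hg => by rw [smul_comm, ha g hg]

/-- The relative trace map `Tr_Q^P`, computed with a choice of coset representatives
(on `Q`-fixed elements it does not depend on this choice). -/
def relTrace (Q P : Subgroup G) (a : A) : A :=
  ∑ᶠ x : P ⧸ Q.subgroupOf P, (((Quotient.out x : P) : G) • a)

/-- The image `A_Q^P = Tr_Q^P(A^Q)`, as a `k`-submodule. -/
def relTraceSub (Q P : Subgroup G) : Submodule k A :=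
  Submodule.span k (relTrace A Q P '' (fixedPts k A Q : Set A))

/-- The kernel of the Brauer homomorphism: `Σ_{Q < P} Tr_Q^P(A^Q)`. -/
def brKerSub (P : Subgroup G) : Submodule k A :=
  ⨆ Q ∈ {Q : Subgroup G | Q < P}, relTraceSub k A Q P

/-- The Brauer quotient `A(P) = A^P / Σ_{Q<P} Tr_Q^P(A^Q)`. -/
abbrev BrauerQuotient (P : Subgroup G) :=
  fixedPts k A P ⧸ (brKerSub k A P).comap (fixedPts k A P).subtype

/-- The Brauer homomorphism `br_P : A^P → A(P)`. -/
def brMap (P : Subgroup G) : fixedPts k A P →ₗ[k] BrauerQuotient k A P :=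
  Submodule.mkQ _

end BrauerMachinery

theorem equivariant_fixed {k : Type*} [Field k] {G : Type*} [Group G]
    {A : Type*} [Ring A] [Algebra k A] [MulSemiringAction G A] [SMulCommClass G k A]
    {B : Type*} [Ring B] [Algebra k B] [MulSemiringAction G B] [SMulCommClass G k B]
    (φ : A →ₗ[k] B) (hφ : ∀ (g : G) (a : A), φ (g • a) = g • φ a) (P : Subgroup G)
    (a : A) (ha : a ∈ fixedPts k A P) : φ a ∈ fixedPts k B P := by
  intro g hg
  rw [← hφ, ha g hg]

theorem equivariant_brKer {k : Type*} [Field k] {G : Type*} [Group G] [Finite G]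
    {A : Type*} [Ring A] [Algebra k A] [MulSemiringAction G A] [SMulCommClass G k A]
    {B : Type*} [Ring B] [Algebra k B] [MulSemiringAction G B] [SMulCommClass G k B]
    (φ : A →ₗ[k] B) (hφ : ∀ (g : G) (a : A), φ (g • a) = g • φ a) (P : Subgroup G) :
    brKerSub k A P ≤ (brKerSub k B P).comap φ := by
  unfold brKerSub
  refine iSup₂_le fun Q hQ => ?_
  refine Submodule.span_le.2 ?_
  rintro _ ⟨a, ha, rfl⟩
  have h1 : φ (relTrace A Q P a) = relTrace B Q P (φ a) := by
    unfold relTrace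
    have := Fintype.ofFinite (P ⧸ Q.subgroupOf P)
    rw [finsum_eq_sum_of_fintype, finsum_eq_sum_of_fintype, map_sum]
    exact Finset.sum_congr rfl fun x _ => hφ _ _
  have h2 : φ (relTrace A Q P a) ∈ relTraceSub k B Q P := by
    rw [h1]
    exact Submodule.subset_span ⟨_, equivariant_fixed φ hφ Q a ha, rfl⟩
  exact (le_iSup₂_of_le (f := fun (Q : Subgroup G) (_ : Q ∈ {Q : Subgroup G | Q < P}) =>
    relTraceSub k B Q P) Q hQ le_rfl) h2

/-- If `f : A → B` is an embedding of `G`-algebras over a field of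
characteristic `p` and `P` is a `p`-subgroup of `G`, then the induced map
`f(P) : A(P) → B(P)` on Brauer quotients, determined by `f(P)(br_P a) = br_P (f a)`,
is again an embedding: it is injective and its image is `br_P(f 1) · B(P) · br_P(f 1)`
(described via representatives `f 1 * b * f 1` with `b ∈ B^P`). -/
theorem stmt6 (k : Type*) [Field k] (G : Type*) [Group G] [Finite G]
    (p : ℕ) [Fact p.Prime] [CharP k p]
    (A : Type*) [Ring A] [Algebra k A] [MulSemiringAction G A] [SMulCommClass G k A]
    (B : Type*) [Ring B] [Algebra k B] [MulSemiringAction G B] [SMulCommClass G k B]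
    (f : A →ₙₐ[k] B) (hinj : Function.Injective f)
    (hequiv : ∀ (g : G) (a : A), f (g • a) = g • f a)
    (him : Set.range f = {x : B | ∃ b : B, x = f 1 * b * f 1})
    (P : Subgroup G) (hP : IsPGroup p P) :
    ∃ F : BrauerQuotient k A P →ₗ[k] BrauerQuotient k B P,
      (∀ (a : fixedPts k A P) (h : f (a : A) ∈ fixedPts k B P),
        F (brMap k A P a) = brMap k B P ⟨f (a : A), h⟩) ∧
      Function.Injective F ∧
      (∀ y : BrauerQuotient k B P, y ∈ Set.range F ↔
        ∃ (b : B) (_ : b ∈ fixedPts k B P) (h2 : f 1 * b * f 1 ∈ fixedPts k B P),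
          y = brMap k B P ⟨f 1 * b * f 1, h2⟩) := by
  have hc : ∀ b : B, ∃ a : A, f a = f 1 * b * f 1 := fun b => by
    have : f 1 * b * f 1 ∈ Set.range f := by rw [him]; exact ⟨b, rfl⟩
    exact this
  choose c hc using hc
  have he : ∀ g : G, g • f 1 = f 1 := fun g => by rw [← hequiv, smul_one]
  let φ : A →ₗ[k] B :=
    { toFun := f, map_add' := map_add f, map_smul' := fun r a => map_smul f r a }
  let ψ : B →ₗ[k] A :=
    { toFun := c
      map_add' := fun x y => hinj (by rw [map_add, hc, hc, hc, mul_add, add_mul])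
      map_smul' := fun r x => hinj (by
        rw [RingHom.id_apply, map_smul, hc, hc, mul_smul_comm, smul_mul_assoc]) }
  have hψ : ∀ (g : G) (b : B), ψ (g • b) = g • ψ b := fun g b => hinj (by
    change f (c (g • b)) = f (g • c b)
    rw [hequiv, hc, hc, smul_mul', smul_mul', he])
  have hψφ : ∀ a, ψ (f a) = a := fun a => hinj (by
    change f (c (f a)) = f a
    rw [hc, ← map_mul, ← map_mul, one_mul, mul_one])
  have hφ : ∀ (g : G) (a : A), φ (g • a) = g • φ a := hequiv
  let φP : fixedPts k A P →ₗ[k] fixedPts k B P :=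
    φ.restrict (equivariant_fixed φ hφ P)
  have hF : ∀ (a : fixedPts k A P) (h : f (a : A) ∈ fixedPts k B P),
      Submodule.mapQ ((brKerSub k A P).comap (fixedPts k A P).subtype)
        ((brKerSub k B P).comap (fixedPts k B P).subtype) φP
        (fun x hx => equivariant_brKer φ hφ P hx) (brMap k A P a)
      = brMap k B P ⟨f (a : A), h⟩ := fun a h => rfl
  refine ⟨_, hF, ?_, ?_⟩
  · rw [injective_iff_map_eq_zero]
    intro x hx
    obtain ⟨a, rfl⟩ := Submodule.mkQ_surjective _ x
    have h1 : f (a : A) ∈ brKerSub k B P :=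
      (Submodule.Quotient.mk_eq_zero ((brKerSub k B P).comap (fixedPts k B P).subtype)
        (x := φP a)).1 hx
    have h2 : ψ (f (a : A)) ∈ brKerSub k A P := equivariant_brKer ψ hψ P h1
    rw [hψφ] at h2
    exact (Submodule.Quotient.mk_eq_zero _).2 h2
  · intro y
    constructor
    · rintro ⟨x, rfl⟩
      obtain ⟨a, rfl⟩ := Submodule.mkQ_surjective _ x
      have h := equivariant_fixed φ hφ P a a.2
      have e : f 1 * f (a : A) * f 1 = f (a : A) := by
        rw [← map_mul, ← map_mul, one_mul, mul_one]
      refine ⟨f (a : A), h, by rw [e]; exact h, ?_⟩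
      refine (hF a h).trans ?_
      congr 2
      exact e.symm
    · rintro ⟨b, hb, h2, rfl⟩
      have h3 := equivariant_fixed ψ hψ P b hb
      refine ⟨brMap k A P ⟨ψ b, h3⟩, ?_⟩
      have h4 : f (ψ b) = f 1 * b * f 1 := hc b
      refine (hF ⟨ψ b, h3⟩ (by rw [h4]; exact h2)).trans ?_
      congr 2
end
end

section
/- Let k' be a field extension of k, G a finite group, M a finitely generated indecomposable kG-module with vertex P. Then P is a vertex of every indecomposable direct summand of the k'G-module k' ⊗_k M. -/
open scoped BigOperators TensorProduct

noncomputable section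

section RepMachinery

variable {k : Type*} [CommRing k] {G : Type*} [Group G]
variable {V : Type*} [AddCommGroup V] [Module k V]

/-- Conjugation of a linear endomorphism by `ρ g`. -/
def conjEnd (ρ : Representation k G V) (g : G) (f : V →ₗ[k] V) : V →ₗ[k] V :=
  ρ g ∘ₗ f ∘ₗ ρ g⁻¹

/-- Higman's criterion: relative projectivity of `ρ` with respect to a subgroup `P ≤ G`:
some `P`-equivariant endomorphism has relative trace `Tr_P^G` equal to the identity. -/
def RelProj (ρ : Representation k G V) (P : Subgroup G) : Prop :=
  ∃ f : V →ₗ[k] V, (∀ u ∈ P, conjEnd ρ u f = f) ∧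
    ∑ᶠ x : G ⧸ P, conjEnd ρ (Quotient.out x) f = LinearMap.id

/-- `P` is a vertex of `ρ`: a minimal subgroup relative to which `ρ` is projective. -/
def IsVertex (ρ : Representation k G V) (P : Subgroup G) : Prop :=
  RelProj ρ P ∧ ∀ Q : Subgroup G, Q < P → ¬ RelProj ρ Q

/-- A `ρ`-stable submodule. -/
def RepStable (ρ : Representation k G V) (N : Submodule k V) : Prop :=
  ∀ g : G, ∀ v ∈ N, ρ g v ∈ N

/-- Indecomposability of a representation. -/
def RepIndecomposable (ρ : Representation k G V) : Prop :=
  Nontrivial V ∧ ∀ N₁ N₂ : Submodule k V, RepStable ρ N₁ → RepStable ρ N₂ →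
    IsCompl N₁ N₂ → N₁ = ⊥ ∨ N₂ = ⊥

variable {W : Type*} [AddCommGroup W] [Module k W]

/-- `(W, σ)` is a direct summand of `(V, ρ)`: there is a split equivariant epi–mono pair. -/
def IsRepSummand (ρ : Representation k G V) (σ : Representation k G W) : Prop :=
  ∃ (π : V →ₗ[k] W) (ι : W →ₗ[k] V), π ∘ₗ ι = LinearMap.id ∧
    (∀ g : G, π ∘ₗ ρ g = σ g ∘ₗ π) ∧ (∀ g : G, ρ g ∘ₗ ι = ι ∘ₗ σ g)

/-- `σ` is a `P`-source of `ρ`: an indecomposable direct summand of the restriction of `ρ`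
to `P` having vertex `P` itself. -/
def IsSource (ρ : Representation k G V) (P : Subgroup G)
    {S : Type*} [AddCommGroup S] [Module k S] (σ : Representation k ↥P S) : Prop :=
  RepIndecomposable σ ∧ IsVertex σ (⊤ : Subgroup ↥P) ∧
    IsRepSummand (ρ.comp P.subtype) σ

end RepMachinery

section Helpers

lemma conjEnd_mul_apply {k : Type*} [CommRing k] {G : Type*} [Group G]
    {V : Type*} [AddCommGroup V] [Module k V] (ρ : Representation k G V) (g : G)
    (f : Module.End k V) : conjEnd ρ g f = ρ g * f * ρ g⁻¹ := rfl

lemma conjEnd_conjEnd {k : Type*} [CommRing k] {G : Type*} [Group G]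
    {V : Type*} [AddCommGroup V] [Module k V] (ρ : Representation k G V) (g h : G)
    (f : Module.End k V) : conjEnd ρ g (conjEnd ρ h f) = conjEnd ρ (g * h) f := by
  simp only [conjEnd_mul_apply, mul_inv_rev, map_mul, mul_assoc]

/-- The relative trace. -/
def relTr {k : Type*} [CommRing k] {G : Type*} [Group G]
    {V : Type*} [AddCommGroup V] [Module k V] (ρ : Representation k G V) (Q : Subgroup G)
    (f : Module.End k V) : Module.End k V :=
  ∑ᶠ x : G ⧸ Q, (conjEnd ρ (Quotient.out x) f : Module.End k V)

lemma relTr_comm {k : Type*} [CommRing k] {G : Type*} [Group G] [Finite G]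
    {V : Type*} [AddCommGroup V] [Module k V] (ρ : Representation k G V) (Q : Subgroup G)
    (f : Module.End k V) (hf : ∀ u ∈ Q, conjEnd ρ u f = f) (g : G) :
    ρ g * relTr ρ Q f = relTr ρ Q f * ρ g := by
  classical
  have := Fintype.ofFinite (G ⧸ Q)
  have key : ∀ (a : G), conjEnd ρ (Quotient.out (a : G ⧸ Q)) f = conjEnd ρ a f := by
    intro a
    obtain ⟨u, hu⟩ := QuotientGroup.mk_out_eq_mul Q a
    rw [hu, ← conjEnd_conjEnd, hf _ u.2]
  have h1 : ∀ x : G ⧸ Q, ρ g * (conjEnd ρ (Quotient.out x) f : Module.End k V) =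
      (conjEnd ρ (Quotient.out (g • x)) f : Module.End k V) * ρ g := by
    intro x
    have h2 : g • x = ((g * Quotient.out x : G) : G ⧸ Q) := by
      conv_lhs => rw [← QuotientGroup.out_eq' x]
      rfl
    rw [h2, key, conjEnd_mul_apply, conjEnd_mul_apply]
    simp only [mul_inv_rev, map_mul, mul_assoc]
    rw [← map_mul ρ g⁻¹ g, inv_mul_cancel, map_one, mul_one]
  unfold relTr
  rw [finsum_eq_sum_of_fintype, Finset.mul_sum, Finset.sum_mul]
  rw [Finset.sum_congr rfl (fun x _ => h1 x)]
  exact Equiv.sum_comp (MulAction.toPerm g : Equiv.Perm (G ⧸ Q))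
    (fun x => (conjEnd ρ (Quotient.out x) f : Module.End k V) * ρ g)

/-- Transport of traces along an equivariant pair. -/
lemma relTr_transport {k : Type*} [CommRing k] {G : Type*} [Group G] [Finite G]
    {V W : Type*} [AddCommGroup V] [Module k V] [AddCommGroup W] [Module k W]
    (ρ : Representation k G V) (σ : Representation k G W) (Q : Subgroup G)
    (π : V →ₗ[k] W) (ι : W →ₗ[k] V)
    (hπ : ∀ g : G, π ∘ₗ ρ g = σ g ∘ₗ π) (hι : ∀ g : G, ρ g ∘ₗ ι = ι ∘ₗ σ g)
    (f : Module.End k V) :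
    (∀ g, conjEnd σ g (π ∘ₗ f ∘ₗ ι) = π ∘ₗ (conjEnd ρ g f) ∘ₗ ι) ∧
    relTr σ Q (π ∘ₗ f ∘ₗ ι) = π ∘ₗ relTr ρ Q f ∘ₗ ι := by
  have h : ∀ g, conjEnd σ g (π ∘ₗ f ∘ₗ ι) = π ∘ₗ (conjEnd ρ g f) ∘ₗ ι := by
    intro g
    ext w
    have h1 := fun v => LinearMap.congr_fun (hπ g) v
    have h2 := fun v => LinearMap.congr_fun (hι g⁻¹) v
    simp only [LinearMap.comp_apply] at h1 h2
    simp [conjEnd, h1, h2]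
  refine ⟨h, ?_⟩
  have := Fintype.ofFinite (G ⧸ Q)
  unfold relTr
  rw [finsum_eq_sum_of_fintype, finsum_eq_sum_of_fintype]
  ext w
  simp [h, LinearMap.sum_apply]

lemma trace_nilpotent {k : Type*} [Field k] {G : Type*} [Group G] [Finite G]
    {M : Type*} [AddCommGroup M] [Module k M] [Module.Finite k M]
    (ρ : Representation k G M) (hind : RepIndecomposable ρ) (Q : Subgroup G)
    (hQ : ¬ RelProj ρ Q) (f : Module.End k M) (hf : ∀ u ∈ Q, conjEnd ρ u f = f) :
    IsNilpotent (relTr ρ Q f) := by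
  set a := relTr ρ Q f with ha
  have hc : ∀ g, Commute (ρ g) a := fun g => relTr_comm ρ Q f hf g
  obtain ⟨n, hn⟩ := Filter.eventually_atTop.1 (LinearMap.eventually_isCompl_ker_pow_range_pow a)
  have hcn : ∀ g v, ρ g ((a ^ (n+1)) v) = (a ^ (n+1)) (ρ g v) := fun g v =>
    LinearMap.congr_fun ((hc g).pow_right (n+1)) v
  have hcompl := hn (n+1) (by omega)
  have hs1 : RepStable ρ (LinearMap.ker (a ^ (n+1))) := by
    intro g v hv
    rw [LinearMap.mem_ker] at hv ⊢
    rw [← hcn, hv, map_zero]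
  have hs2 : RepStable ρ (LinearMap.range (a ^ (n+1))) := by
    rintro g _ ⟨v, rfl⟩
    exact ⟨ρ g v, (hcn g v).symm⟩
  rcases hind.2 _ _ hs1 hs2 hcompl with h | h
  · exfalso
    have htop : LinearMap.range (a ^ (n+1)) = ⊤ := by
      rw [h] at hcompl
      simpa using hcompl.sup_eq_top
    have hu : IsUnit (a ^ (n+1)) := (Module.End.isUnit_iff _).2
      ⟨LinearMap.ker_eq_bot.1 h, LinearMap.range_eq_top.1 htop⟩
    obtain ⟨u, hu⟩ := (isUnit_pow_iff (Nat.succ_ne_zero n)).1 hu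
    apply hQ
    have hcu : ∀ g, Commute (ρ g) (↑u⁻¹ : Module.End k M) := fun g => by
      have := hc g
      rw [← hu] at this
      exact this.units_inv_right
    obtain ⟨h1, h2⟩ := relTr_transport ρ ρ Q (↑u⁻¹ : Module.End k M) LinearMap.id
      (fun g => (hcu g).symm) (fun g => rfl) f
    refine ⟨_, fun v hv => ?_, h2.trans ?_⟩
    · rw [h1, hf v hv]
    · change (↑u⁻¹ : Module.End k M) * a = 1
      rw [← hu]; simp
  · exact ⟨n+1, LinearMap.range_eq_bot.1 h⟩

/-- Coordinates of an equivariant endomorphism of `k' ⊗ M`. -/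
lemma exists_coords {k k' : Type*} [Field k] [Field k'] [Algebra k k']
    {G : Type*} [Group G] {M : Type*} [AddCommGroup M] [Module k M] [Module.Finite k M]
    (ρ : Representation k G M) (ρ' : Representation k' G (k' ⊗[k] M))
    (hcompat : ∀ g, ρ' g = (ρ g).baseChange k')
    (Q : Subgroup G) (f : Module.End k' (k' ⊗[k] M)) (hf : ∀ u ∈ Q, conjEnd ρ' u f = f) :
    f ∈ Submodule.span k' ((fun a : Module.End k M => (a.baseChange k' : Module.End k' (k' ⊗[k] M)))
      '' {a | ∀ u ∈ Q, conjEnd ρ u a = a}) := by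
  classical
  let b := Module.Basis.ofVectorSpace k k'
  let φ (i) : k' ⊗[k] M →ₗ[k] M := (TensorProduct.lid k M).toLinearMap ∘ₗ (b.coord i).rTensor M
  let F (i) : Module.End k M :=
    φ i ∘ₗ (f.restrictScalars k) ∘ₗ (TensorProduct.mk k k' M 1)
  have hφ : ∀ i z, φ i z = TensorProduct.equivFinsuppOfBasisLeft b z i := by
    intro i z; rw [TensorProduct.equivFinsuppOfBasisLeft_apply]; rfl
  have hφρ : ∀ i (a : Module.End k M) z, φ i (a.baseChange k' z) = a (φ i z) := by
    intro i a z
    induction z with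
    | zero => simp
    | add x y hx hy => simp [hx, hy]
    | tmul c m => simp [φ]
  have hFQ : ∀ i, ∀ u ∈ Q, conjEnd ρ u (F i) = F i := by
    intro i u hu
    ext m
    have h := LinearMap.congr_fun (hf u hu) (1 ⊗ₜ m)
    simp only [conjEnd, LinearMap.comp_apply, hcompat, LinearMap.baseChange_tmul] at h
    simp only [conjEnd, F, LinearMap.comp_apply, TensorProduct.mk_apply,
      LinearMap.restrictScalars_apply]
    rw [← h, hφρ]
  obtain ⟨t, ht⟩ := (Module.Finite.fg_top : (⊤ : Submodule k M).FG)
  let S := t.biUnion fun m => (TensorProduct.equivFinsuppOfBasisLeft b (f (1 ⊗ₜ m))).support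
  have hS : ∀ i, i ∉ S → F i = 0 := by
    intro i hi
    apply LinearMap.ext_on ht
    intro m hm
    have : i ∉ (TensorProduct.equivFinsuppOfBasisLeft b (f (1 ⊗ₜ m))).support := fun h =>
      hi (Finset.mem_biUnion.2 ⟨m, hm, h⟩)
    rw [Finsupp.notMem_support_iff, ← hφ] at this
    exact this
  have hfe : f = ∑ i ∈ S, b i • ((F i).baseChange k' : Module.End k' (k' ⊗[k] M)) := by
    apply TensorProduct.AlgebraTensorModule.curry_injective
    ext m
    change f (1 ⊗ₜ m) = (∑ i ∈ S, b i • ((F i).baseChange k' : Module.End k' (k' ⊗[k] M))) (1 ⊗ₜ m)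
    conv_lhs => rw [← (TensorProduct.equivFinsuppOfBasisLeft b).symm_apply_apply (f (1 ⊗ₜ m)),
      TensorProduct.equivFinsuppOfBasisLeft_symm_apply]
    rw [Finsupp.sum_of_support_subset (s := S)]
    · simp [← hφ, F, TensorProduct.smul_tmul']
    · intro i hi
      by_contra hi'
      rw [Finsupp.mem_support_iff, ← hφ] at hi
      exact hi (LinearMap.congr_fun (hS i hi') m)
    · simp
  rw [hfe]
  exact Submodule.sum_mem _ fun i _ => Submodule.smul_mem _ _
    (Submodule.subset_span ⟨F i, hFQ i, rfl⟩)

lemma conjEnd_baseChange {k k' : Type*} [Field k] [Field k'] [Algebra k k']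
    {G : Type*} [Group G] {M : Type*} [AddCommGroup M] [Module k M]
    (ρ : Representation k G M) (ρ' : Representation k' G (k' ⊗[k] M))
    (hcompat : ∀ g, ρ' g = (ρ g).baseChange k') (g : G) (a : Module.End k M) :
    conjEnd ρ' g (a.baseChange k') = (conjEnd ρ g a).baseChange k' := by
  simp only [conjEnd, hcompat, LinearMap.baseChange_comp]

lemma relTr_baseChange {k k' : Type*} [Field k] [Field k'] [Algebra k k']
    {G : Type*} [Group G] [Finite G] {M : Type*} [AddCommGroup M] [Module k M]
    (ρ : Representation k G M) (ρ' : Representation k' G (k' ⊗[k] M))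
    (hcompat : ∀ g, ρ' g = (ρ g).baseChange k') (Q : Subgroup G) (a : Module.End k M) :
    relTr ρ' Q (a.baseChange k') = (relTr ρ Q a).baseChange k' := by
  have := Fintype.ofFinite (G ⧸ Q)
  unfold relTr
  rw [finsum_eq_sum_of_fintype, finsum_eq_sum_of_fintype]
  simp only [conjEnd_baseChange ρ ρ' hcompat]
  exact (map_sum (LinearMap.baseChangeHom k k' M M) _ _).symm

lemma relTr_add {k : Type*} [CommRing k] {G : Type*} [Group G] [Finite G]
    {V : Type*} [AddCommGroup V] [Module k V] (ρ : Representation k G V) (Q : Subgroup G)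
    (f g : Module.End k V) : relTr ρ Q (f + g) = relTr ρ Q f + relTr ρ Q g := by
  have := Fintype.ofFinite (G ⧸ Q)
  unfold relTr
  simp only [finsum_eq_sum_of_fintype, conjEnd_mul_apply, mul_add, add_mul,
    Finset.sum_add_distrib]

lemma relTr_smul {k : Type*} [CommRing k] {G : Type*} [Group G] [Finite G]
    {V : Type*} [AddCommGroup V] [Module k V] (ρ : Representation k G V) (Q : Subgroup G)
    (c : k) (f : Module.End k V) : relTr ρ Q (c • f) = c • relTr ρ Q f := by
  have := Fintype.ofFinite (G ⧸ Q)
  unfold relTr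
  simp only [finsum_eq_sum_of_fintype, conjEnd_mul_apply, mul_smul_comm, smul_mul_assoc,
    Finset.smul_sum]

/-- The trace of an invariant endomorphism of `k' ⊗ M` is nilpotent. -/
lemma trace_nilpotent' {k k' : Type*} [Field k] [Field k'] [Algebra k k']
    {G : Type*} [Group G] [Finite G]
    {M : Type*} [AddCommGroup M] [Module k M] [Module.Finite k M]
    (ρ : Representation k G M) (hind : RepIndecomposable ρ)
    (ρ' : Representation k' G (k' ⊗[k] M))
    (hcompat : ∀ g, ρ' g = (ρ g).baseChange k')
    (Q : Subgroup G) (hQ : ¬ RelProj ρ Q)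
    (f : Module.End k' (k' ⊗[k] M)) (hf : ∀ u ∈ Q, conjEnd ρ' u f = f) :
    ∃ n, (relTr ρ' Q f) ^ (n + 1) = 0 := by
  let A : Subalgebra k (Module.End k M) := Subalgebra.centralizer k (Set.range ρ)
  have : IsArtinianRing A := IsArtinianRing.of_finite k A
  let R : Ideal A := Ideal.jacobson ⊥
  let B (I : Ideal A) : Submodule k' (Module.End k' (k' ⊗[k] M)) :=
    Submodule.span k' ((fun a : A => ((a : Module.End k M).baseChange k' :
      Module.End k' (k' ⊗[k] M))) '' (I : Set A))
  have hmul : ∀ I J x y, x ∈ B I → y ∈ B J → x * y ∈ B (I * J) := by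
    intro I J x y hx hy
    have h := Submodule.mul_mem_mul hx hy
    rw [Submodule.span_mul_span] at h
    refine Submodule.span_mono ?_ h
    rintro _ ⟨_, ⟨a, ha, rfl⟩, _, ⟨b, hb, rfl⟩, rfl⟩
    refine ⟨a * b, Ideal.mul_mem_mul ha hb, ?_⟩
    exact LinearMap.baseChange_mul _ _
  have hT : ∀ a : Module.End k M, (∀ u ∈ Q, conjEnd ρ u a = a) →
      ∃ r ∈ R, (r : Module.End k M) = relTr ρ Q a := by
    intro a ha
    have hmem : relTr ρ Q a ∈ A := by
      rw [Subalgebra.mem_centralizer_iff]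
      rintro _ ⟨g, rfl⟩
      exact relTr_comm ρ Q a ha g
    refine ⟨⟨_, hmem⟩, ?_, rfl⟩
    rw [Ideal.mem_jacobson_iff]
    intro y
    have hy : ∀ g, (y : Module.End k M) * ρ g = ρ g * y := fun g =>
      ((Subalgebra.mem_centralizer_iff k).1 y.2 _ ⟨g, rfl⟩).symm
    obtain ⟨h1, h2⟩ := relTr_transport ρ ρ Q (y : Module.End k M) LinearMap.id hy
      (fun g => rfl) a
    have h3 := trace_nilpotent ρ hind Q hQ _ (fun u hu => by rw [h1, ha u hu])
    rw [h2] at h3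
    have h4 : IsNilpotent (y * ⟨_, hmem⟩ : A) := by
      obtain ⟨n, hn⟩ := h3
      exact ⟨n, Subtype.ext hn⟩
    obtain ⟨u, hu⟩ := h4.isUnit_add_one
    refine ⟨↑u⁻¹, ?_⟩
    have h5 := u.inv_mul
    rw [hu, mul_add, mul_one, ← mul_assoc] at h5
    rw [h5]; simp
  have hB : relTr ρ' Q f ∈ B R := by
    have h := exists_coords ρ ρ' hcompat Q f hf
    let T : Module.End k' (k' ⊗[k] M) →ₗ[k'] Module.End k' (k' ⊗[k] M) :=
      { toFun := relTr ρ' Q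
        map_add' := relTr_add ρ' Q
        map_smul' := relTr_smul ρ' Q }
    have hle : Submodule.span k' ((fun a : Module.End k M => (a.baseChange k' :
        Module.End k' (k' ⊗[k] M))) '' {a | ∀ u ∈ Q, conjEnd ρ u a = a}) ≤ (B R).comap T := by
      rw [Submodule.span_le]
      rintro _ ⟨a, ha, rfl⟩
      obtain ⟨r, hr, hra⟩ := hT a ha
      refine Submodule.subset_span ⟨r, hr, ?_⟩
      change _ = relTr ρ' Q _
      simp only [relTr_baseChange ρ ρ' hcompat, hra]
    exact hle h
  obtain ⟨n, hn⟩ : IsNilpotent R := IsArtinianRing.isNilpotent_jacobson_bot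
  have hpow : ∀ n, (relTr ρ' Q f) ^ (n + 1) ∈ B (R ^ (n + 1)) := by
    intro n
    induction n with
    | zero => simpa [Submodule.pow_one] using hB
    | succ n ih =>
      rw [pow_succ _ (n + 1), Submodule.pow_succ R]
      exact hmul _ _ _ _ ih hB
  refine ⟨n, ?_⟩
  have h := hpow n
  have h0 : R ^ (n + 1) = ⊥ := by
    rw [Submodule.pow_succ, hn, Submodule.zero_eq_bot, Ideal.bot_mul]
  rw [h0] at h
  simpa [B] using h

end Helpers

/-- Let `k ⊆ k'` be a field extension (char `k = p`), `G` a finite group,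
and `M` a finitely generated indecomposable `kG`-module with vertex `P`.  Then `P` is a
vertex of every indecomposable direct summand of the `k'G`-module `k' ⊗_k M`. -/
theorem stmt14 (k k' : Type*) [Field k] [Field k'] [Algebra k k']
    (p : ℕ) [Fact p.Prime] [CharP k p]
    (G : Type*) [Group G] [Finite G]
    (M : Type*) [AddCommGroup M] [Module k M] [Module.Finite k M]
    (ρ : Representation k G M) (hind : RepIndecomposable ρ)
    (P : Subgroup G) (hvx : IsVertex ρ P)
    (ρ' : Representation k' G (k' ⊗[k] M))
    (hcompat : ∀ (g : G) (c : k') (m : M), ρ' g (c ⊗ₜ[k] m) = c ⊗ₜ[k] (ρ g m))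
    (W : Type*) [AddCommGroup W] [Module k' W]
    (σ : Representation k' G W) (hsummand : IsRepSummand ρ' σ)
    (hindW : RepIndecomposable σ) :
    IsVertex σ P := by
  have hc : ∀ g, ρ' g = (ρ g).baseChange k' := by
    intro g
    apply TensorProduct.AlgebraTensorModule.curry_injective
    ext m
    simp [hcompat]
  obtain ⟨π, ι, hπι, hπ, hι⟩ := hsummand
  constructor
  · obtain ⟨f, hf, hf1⟩ := hvx.1
    obtain ⟨h1, h2⟩ := relTr_transport ρ' σ P π ι hπ hι (f.baseChange k')
    refine ⟨π ∘ₗ (f.baseChange k') ∘ₗ ι, fun u hu => ?_, h2.trans ?_⟩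
    · rw [h1, conjEnd_baseChange ρ ρ' hc, hf u hu]
    · have hf2 : relTr ρ P f = LinearMap.id := hf1
      rw [relTr_baseChange ρ ρ' hc, hf2, LinearMap.baseChange_id, LinearMap.id_comp, hπι]
  · rintro Q hQP ⟨f, hf, hf1⟩
    obtain ⟨h1, h2⟩ := relTr_transport σ ρ' Q ι π (fun g => (hι g).symm)
      (fun g => (hπ g).symm) f
    have hf2 : relTr σ Q f = LinearMap.id := hf1
    rw [hf2, LinearMap.id_comp] at h2
    obtain ⟨n, hn⟩ := trace_nilpotent' ρ hind ρ' hc Q (hvx.2 Q hQP) (ι ∘ₗ f ∘ₗ π)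
      (fun u hu => by rw [h1, hf u hu])
    rw [h2] at hn
    have hid : IsIdempotentElem (ι ∘ₗ π : Module.End k' (k' ⊗[k] M)) := by
      change (ι ∘ₗ π) ∘ₗ (ι ∘ₗ π) = ι ∘ₗ π
      rw [LinearMap.comp_assoc, ← LinearMap.comp_assoc π ι π, hπι, LinearMap.id_comp]
    rw [hid.pow_succ_eq] at hn
    obtain ⟨w, hw⟩ := @exists_ne W hindW.1 0
    apply hw
    have e1 : ∀ w, π (ι w) = w := fun w => LinearMap.congr_fun hπι w
    have e2 := LinearMap.congr_fun hn (ι w)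
    simp only [LinearMap.comp_apply, e1] at e2
    rw [← e1 w, e2]; simp
end
end

section
/- Let k' ⊇ k be a field extension, G a finite group, M a finitely generated indecomposable kG-module with vertex P, U' an indecomposable direct summand of k' ⊗_k M with k'P-source V'. If V' ≅ k' ⊗_k V for some kP-module V, then V is a kP-source of M, and moreover every indecomposable direct summand of k' ⊗_k M has V' as a source. -/
open scoped BigOperators TensorProduct

noncomputable section

section Helpers

/-- Equivariance of a linear map. -/
def Eqv {k : Type*} [CommRing k] {G : Type*} [Group G]
    {V : Type*} [AddCommGroup V] [Module k V] {W : Type*} [AddCommGroup W] [Module k W]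
    (ρ : Representation k G V) (σ : Representation k G W) (f : V →ₗ[k] W) : Prop :=
  ∀ g x, f (ρ g x) = σ g (f x)

section A
variable {k : Type*} [CommRing k] {G : Type*} [Group G]
variable {V : Type*} [AddCommGroup V] [Module k V]
variable {W : Type*} [AddCommGroup W] [Module k W]
variable {X : Type*} [AddCommGroup X] [Module k X]

lemma rep_inv_self (ρ : Representation k G V) (g : G) (v : V) : ρ g⁻¹ (ρ g v) = v := by
  rw [← Module.End.mul_apply, ← map_mul]; simp

lemma rep_self_inv (ρ : Representation k G V) (g : G) (v : V) : ρ g (ρ g⁻¹ v) = v := by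
  rw [← Module.End.mul_apply, ← map_mul]; simp

lemma rep_mul (ρ : Representation k G V) (g h : G) (v : V) : ρ (g * h) v = ρ g (ρ h v) := by
  rw [map_mul]; rfl

lemma Eqv.comp {ρ : Representation k G V} {σ : Representation k G W} {τ : Representation k G X}
    {f : W →ₗ[k] X} {h : V →ₗ[k] W} (hf : Eqv σ τ f) (hh : Eqv ρ σ h) : Eqv ρ τ (f ∘ₗ h) := by
  intro g x; simp [hh g x, hf g]

lemma Eqv.id (ρ : Representation k G V) : Eqv ρ ρ LinearMap.id := fun _ _ => rfl

lemma Eqv.add {ρ : Representation k G V} {σ : Representation k G W} {f h : V →ₗ[k] W}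
    (hf : Eqv ρ σ f) (hh : Eqv ρ σ h) : Eqv ρ σ (f + h) := by
  intro g x; simp [hf g x, hh g x]

lemma Eqv.zero {ρ : Representation k G V} {σ : Representation k G W} :
    Eqv ρ σ (0 : V →ₗ[k] W) := by
  intro g x; simp

lemma Eqv.sum {ι : Type*} {ρ : Representation k G V} {σ : Representation k G W}
    {f : ι → V →ₗ[k] W} (s : Finset ι) (hf : ∀ i ∈ s, Eqv ρ σ (f i)) : Eqv ρ σ (∑ i ∈ s, f i) := by
  classical
  induction s using Finset.induction_on with
  | empty => simpa using Eqv.zero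
  | insert a s ha ih =>
    rw [Finset.sum_insert ha]
    exact (hf a (by simp)).add (ih fun i hi => hf i (by simp [hi]))

lemma Eqv.symm {ρ : Representation k G V} {σ : Representation k G W} {e : V ≃ₗ[k] W}
    (h : Eqv ρ σ e.toLinearMap) : Eqv σ ρ e.symm.toLinearMap := by
  intro g x
  apply e.injective
  have := h g (e.symm x)
  simp at this
  simp [this]

lemma Eqv.pow {ρ : Representation k G V} {f : Module.End k V} (hf : Eqv ρ ρ f) (n : ℕ) :
    Eqv ρ ρ (f ^ n : Module.End k V) := by
  induction n with
  | zero => intro g x; simp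
  | succ n ih => rw [pow_succ]; exact ih.comp hf

/-- Indecomposability via idempotents. -/
lemma indec_idem {ρ : Representation k G V} (h : RepIndecomposable ρ) {f : V →ₗ[k] V}
    (hf : Eqv ρ ρ f) (hi : f ∘ₗ f = f) : f = 0 ∨ f = LinearMap.id := by
  have hi' : ∀ x, f (f x) = f x := fun x => LinearMap.congr_fun hi x
  have := h.2 (LinearMap.range f) (LinearMap.ker f) ?_ ?_ ?_
  · rcases this with h1 | h1
    · left; exact LinearMap.range_eq_bot.1 h1
    · right
      ext x
      have : f x - x ∈ LinearMap.ker f := by simp [hi']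
      rw [h1] at this
      simpa [sub_eq_zero] using this
  · rintro g _ ⟨x, rfl⟩
    exact ⟨ρ g x, hf g x⟩
  · intro g v hv
    simp only [LinearMap.mem_ker] at hv ⊢
    rw [hf, hv, map_zero]
  · constructor
    · rw [Submodule.disjoint_def]
      rintro _ ⟨x, rfl⟩ hx
      simpa [hi'] using hx
    · rw [codisjoint_iff, eq_top_iff]
      intro x _
      rw [Submodule.mem_sup]
      exact ⟨f x, ⟨x, rfl⟩, x - f x, by simp [hi'], by simp⟩

lemma indec_of_idem {ρ : Representation k G V} (hn : Nontrivial V)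
    (h : ∀ f : V →ₗ[k] V, Eqv ρ ρ f → f ∘ₗ f = f → f = 0 ∨ f = LinearMap.id) :
    RepIndecomposable ρ := by
  refine ⟨hn, fun N₁ N₂ h1 h2 hc => ?_⟩
  set f := N₁.projection N₂ hc with hf
  have e1 : ∀ x ∈ N₁, f x = x := fun x hx => by
    simpa [hf] using Submodule.projection_apply_left hc ⟨x, hx⟩
  have e2 : ∀ x ∈ N₂, f x = 0 := fun x hx => by
    simpa [hf] using hx
  have hdec : ∀ x : V, ∃ y ∈ N₁, ∃ z ∈ N₂, y + z = x := fun x =>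
    Submodule.mem_sup.1 (by rw [hc.sup_eq_top]; trivial)
  have hE : Eqv ρ ρ f := by
    intro g x
    obtain ⟨y, hy, z, hz, rfl⟩ := hdec x
    simp only [map_add]
    rw [e1 y hy, e2 z hz, e1 _ (h1 g y hy), e2 _ (h2 g z hz)]; simp
  have hI : f ∘ₗ f = f := by
    ext x
    obtain ⟨y, hy, z, hz, rfl⟩ := hdec x
    simp [e1 y hy, e2 z hz]
  rcases h f hE hI with h0 | h0
  · left
    rw [Submodule.eq_bot_iff]
    intro x hx
    rw [← e1 x hx, h0]; rfl
  · right
    rw [Submodule.eq_bot_iff]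
    intro x hx
    rw [← e2 x hx, h0]; rfl

lemma indec_equiv {ρ : Representation k G V} {σ : Representation k G W} (e : V ≃ₗ[k] W)
    (he : Eqv ρ σ e.toLinearMap) (h : RepIndecomposable σ) : RepIndecomposable ρ := by
  have := h.1
  refine indec_of_idem e.toEquiv.nontrivial fun f hf hi => ?_
  have hi' : ∀ x, f (f x) = f x := fun x => LinearMap.congr_fun hi x
  rcases indec_idem h (f := e.toLinearMap ∘ₗ f ∘ₗ e.symm.toLinearMap)
    (he.comp (hf.comp he.symm)) (by ext x; simp [hi']) with h0 | h0
  · left; ext x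
    have := LinearMap.congr_fun h0 (e x)
    simpa using this
  · right; ext x
    have := LinearMap.congr_fun h0 (e x)
    simpa using this

end A

section F
variable {k : Type*} [Field k] {G : Type*} [Group G]
variable {V : Type*} [AddCommGroup V] [Module k V] [Module.Finite k V]

lemma fitting {ρ : Representation k G V} (h : RepIndecomposable ρ) {f : Module.End k V}
    (hf : Eqv ρ ρ f) : IsNilpotent f ∨ Function.Bijective f := by
  obtain ⟨n, hn⟩ := Filter.eventually_atTop.1 (LinearMap.eventually_isCompl_ker_pow_range_pow f)
  have hc := hn (n + 1) (by omega)
  have hfn := hf.pow (n + 1)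
  have hk : RepStable ρ (LinearMap.ker (f ^ (n + 1) : Module.End k V)) := by
    intro g v hv
    simp only [LinearMap.mem_ker] at hv ⊢
    rw [hfn, hv, map_zero]
  have hr : RepStable ρ (LinearMap.range (f ^ (n + 1) : Module.End k V)) := by
    rintro g _ ⟨x, rfl⟩
    exact ⟨ρ g x, hfn g x⟩
  rcases h.2 _ _ hk hr hc with h0 | h0
  · right
    have hinj : Function.Injective f := by
      have h1 : Function.Injective (f ^ (n + 1) : Module.End k V) := LinearMap.ker_eq_bot.1 h0
      rw [pow_succ] at h1
      exact Function.Injective.of_comp (f := (f ^ n : Module.End k V)) h1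
    exact ⟨hinj, LinearMap.injective_iff_surjective.1 hinj⟩
  · left
    exact ⟨n + 1, LinearMap.range_eq_bot.1 h0⟩

lemma exists_inv {V W : Type*} [AddCommGroup V] [Module k V] [AddCommGroup W] [Module k W]
    {ρ : Representation k G V} {σ : Representation k G W} {f : V →ₗ[k] W}
    (hf : Eqv ρ σ f) (hb : Function.Bijective f) :
    ∃ f' : W →ₗ[k] V, Eqv σ ρ f' ∧ (∀ x, f' (f x) = x) ∧ ∀ x, f (f' x) = x := by
  let e := LinearEquiv.ofBijective f hb
  refine ⟨e.symm, Eqv.symm (e := e) hf, fun x => e.symm_apply_apply x, fun x => e.apply_symm_apply x⟩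

lemma local_add {ρ : Representation k G V} (h : RepIndecomposable ρ) {f f' : Module.End k V}
    (hf : Eqv ρ ρ f) (hf' : Eqv ρ ρ f') (hb : Function.Bijective (f + f' : Module.End k V)) :
    Function.Bijective f ∨ Function.Bijective f' := by
  obtain ⟨u, hu, hu1, hu2⟩ := exists_inv (hf.add hf') hb
  have h1 : Eqv ρ ρ (u * f : Module.End k V) := hu.comp hf
  have hs : u * f + u * f' = 1 := by
    ext x; have := hu1 x; simpa using this
  rcases fitting h h1 with h2 | h2
  · right
    have h3 : IsUnit (u * f') := by
      rw [eq_sub_of_add_eq' hs]; exact h2.isUnit_one_sub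
    have h4 := (Module.End.isUnit_iff _).1 h3
    have : Function.Injective f' := Function.Injective.of_comp (f := u) h4.1
    exact ⟨this, LinearMap.injective_iff_surjective.1 this⟩
  · left
    have : Function.Injective f := Function.Injective.of_comp (f := u) h2.1
    exact ⟨this, LinearMap.injective_iff_surjective.1 this⟩

lemma local_sum {ι : Type*} {ρ : Representation k G V} (h : RepIndecomposable ρ)
    {f : ι → Module.End k V} (s : Finset ι) (hf : ∀ i ∈ s, Eqv ρ ρ (f i))
    (hb : Function.Bijective (∑ i ∈ s, f i : Module.End k V)) :
    ∃ i ∈ s, Function.Bijective (f i) := by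
  classical
  have := h.1
  induction s using Finset.induction_on with
  | empty =>
    obtain ⟨x, hx⟩ := exists_ne (0 : V)
    exact absurd (hb.1 (a₁ := x) (a₂ := 0) (by simp)) hx
  | insert a s ha ih =>
    rw [Finset.sum_insert ha] at hb
    rcases local_add h (hf a (by simp)) (Eqv.sum s fun i hi => hf i (by simp [hi])) hb with h1 | h1
    · exact ⟨a, by simp, h1⟩
    · obtain ⟨i, hi, h2⟩ := ih (fun i hi => hf i (by simp [hi])) h1
      exact ⟨i, by simp [hi], h2⟩

/-- The endomorphism algebra. -/
def endAlg (ρ : Representation k G V) : Subalgebra k (Module.End k V) where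
  carrier := {f | Eqv ρ ρ f}
  mul_mem' := fun ha hb => ha.comp hb
  add_mem' := fun ha hb => ha.add hb
  algebraMap_mem' := fun r g x => by simp [Module.algebraMap_end_apply]

lemma rad_nilp {ρ : Representation k G V} (h : RepIndecomposable ρ) :
    ∃ J : Ideal (endAlg ρ), IsNilpotent J ∧
      ∀ f : endAlg ρ, ¬ Function.Bijective (f : Module.End k V) → f ∈ J := by
  have : IsArtinianRing (endAlg ρ) := IsArtinianRing.of_finite k _
  refine ⟨_, IsArtinianRing.isNilpotent_jacobson_bot, fun f hf => ?_⟩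
  rw [Ideal.mem_jacobson_iff]
  intro y
  have hy : Eqv ρ ρ ((y * f : endAlg ρ) : Module.End k V) := (y * f).2
  have hnil : IsNilpotent ((y * f : endAlg ρ) : Module.End k V) := by
    refine (fitting h hy).resolve_right fun hb => hf ?_
    have : Function.Injective (f : Module.End k V) :=
      Function.Injective.of_comp (f := (y : Module.End k V)) hb.1
    exact ⟨this, LinearMap.injective_iff_surjective.1 this⟩
  have hnil' : IsNilpotent (y * f) := by
    obtain ⟨n, hn⟩ := hnil
    exact ⟨n, Subtype.ext (by simpa using hn)⟩
  obtain ⟨u, hu⟩ := hnil'.isUnit_one_add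
  refine ⟨(u⁻¹ : (endAlg ρ)ˣ), ?_⟩
  have h1 : ((u⁻¹ : (endAlg ρ)ˣ) : endAlg ρ) * (1 + y * f) = 1 := by rw [← hu]; simp
  rw [mul_add, mul_one, ← mul_assoc] at h1
  rw [add_comm] at h1
  simp [h1]

end F
section T
variable {k : Type*} [CommRing k] {G : Type*} [Group G]
variable {V : Type*} [AddCommGroup V] [Module k V]
variable {W : Type*} [AddCommGroup W] [Module k W]

/-- Restriction to a subgroup. -/
abbrev resP (ρ : Representation k G V) (P : Subgroup G) : Representation k ↥P V :=
  ρ.comp P.subtype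

lemma conjEnd_apply' (ρ : Representation k G V) (g : G) (f : V →ₗ[k] V) (v : V) :
    conjEnd ρ g f v = ρ g (f (ρ g⁻¹ v)) := rfl

lemma conjEnd_mul (ρ : Representation k G V) (g h : G) (f : V →ₗ[k] V) :
    conjEnd ρ (g * h) f = conjEnd ρ g (conjEnd ρ h f) := by
  ext v; simp [conjEnd_apply']

lemma inv_iff (ρ : Representation k G V) (P : Subgroup G) (f : V →ₗ[k] V) :
    (∀ u ∈ P, conjEnd ρ u f = f) ↔ Eqv (resP ρ P) (resP ρ P) f := by
  constructor
  · intro h u x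
    have := LinearMap.congr_fun (h u u.2) (ρ u x)
    rw [conjEnd_apply', rep_inv_self] at this
    exact this.symm
  · intro h u hu
    ext x
    have h1 : f (ρ u (ρ u⁻¹ x)) = ρ u (f (ρ u⁻¹ x)) := h ⟨u, hu⟩ (ρ u⁻¹ x)
    rw [conjEnd_apply', ← h1, rep_self_inv]

/-- Relative trace. -/
def trG (ρ : Representation k G V) (P : Subgroup G) (f : V →ₗ[k] V) : V →ₗ[k] V :=
  ∑ᶠ x : G ⧸ P, conjEnd ρ (Quotient.out x) f

lemma relProj_iff (ρ : Representation k G V) (P : Subgroup G) :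
    RelProj ρ P ↔ ∃ f, Eqv (resP ρ P) (resP ρ P) f ∧ trG ρ P f = LinearMap.id := by
  unfold RelProj trG
  simp only [inv_iff]

lemma conj_congr {ρ : Representation k G V} {P : Subgroup G} {f : V →ₗ[k] V}
    (hf : Eqv (resP ρ P) (resP ρ P) f) {x y : G} (h : (x : G ⧸ P) = (y : G ⧸ P)) :
    conjEnd ρ x f = conjEnd ρ y f := by
  rw [QuotientGroup.eq] at h
  have h2 : y = x * (x⁻¹ * y) := by group
  rw [h2, conjEnd_mul, (inv_iff ρ P f).2 hf _ h]

lemma conj_out {ρ : Representation k G V} {P : Subgroup G} {f : V →ₗ[k] V}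
    (hf : Eqv (resP ρ P) (resP ρ P) f) (y : G) :
    conjEnd ρ (Quotient.out (y : G ⧸ P)) f = conjEnd ρ y f :=
  conj_congr hf (QuotientGroup.out_eq' _)

variable [Finite G]

lemma trG_apply (ρ : Representation k G V) (P : Subgroup G) [Fintype (G ⧸ P)] (f : V →ₗ[k] V) :
    trG ρ P f = ∑ x : G ⧸ P, conjEnd ρ (Quotient.out x) f := by
  unfold trG; rw [finsum_eq_sum_of_fintype]

lemma trG_add (ρ : Representation k G V) (P : Subgroup G) (f f' : V →ₗ[k] V) :
    trG ρ P (f + f') = trG ρ P f + trG ρ P f' := by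
  have := Fintype.ofFinite (G ⧸ P)
  simp only [trG_apply, ← Finset.sum_add_distrib]
  refine Finset.sum_congr rfl fun x _ => ?_
  ext v; simp [conjEnd_apply']

lemma trG_zero (ρ : Representation k G V) (P : Subgroup G) : trG ρ P 0 = 0 := by
  have := trG_add ρ P 0 0
  simpa using this

lemma trG_natural {ρ : Representation k G V} {σ : Representation k G W} (P : Subgroup G)
    {π : V →ₗ[k] W} {ι : W →ₗ[k] V} (hπ : Eqv ρ σ π) (hι : Eqv σ ρ ι) (f : V →ₗ[k] V) :
    trG σ P (π ∘ₗ f ∘ₗ ι) = π ∘ₗ trG ρ P f ∘ₗ ι := by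
  have := Fintype.ofFinite (G ⧸ P)
  ext v
  simp [trG_apply, conjEnd_apply', hπ _ _, hι _ _]

lemma trG_comp_left {ρ : Representation k G V} (P : Subgroup G)
    {π : V →ₗ[k] V} (hπ : Eqv ρ ρ π) (f : V →ₗ[k] V) :
    trG ρ P (π ∘ₗ f) = π ∘ₗ trG ρ P f :=
  trG_natural P hπ (Eqv.id ρ) f

lemma trG_eqv {ρ : Representation k G V} {P : Subgroup G} {f : V →ₗ[k] V}
    (hf : Eqv (resP ρ P) (resP ρ P) f) : Eqv ρ ρ (trG ρ P f) := by
  have := Fintype.ofFinite (G ⧸ P)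
  suffices h : ∀ g, conjEnd ρ g (trG ρ P f) = trG ρ P f by
    intro g x
    have := LinearMap.congr_fun (h g) (ρ g x)
    rw [conjEnd_apply', rep_inv_self] at this
    exact this.symm
  intro g
  have h1 : conjEnd ρ g (trG ρ P f) = ∑ x : G ⧸ P, conjEnd ρ (Quotient.out (g • x)) f := by
    ext v
    simp only [trG_apply, conjEnd_apply', LinearMap.sum_apply, map_sum]
    refine Finset.sum_congr rfl fun x _ => ?_
    have : conjEnd ρ (Quotient.out (g • x)) f = conjEnd ρ (g * Quotient.out x) f := by
      apply conj_congr hf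
      rw [QuotientGroup.out_eq']
      conv_lhs => rw [← QuotientGroup.out_eq' x]
      rfl
    rw [← conjEnd_apply' ρ (Quotient.out (g • x)), this, conjEnd_mul]
    rfl
  rw [h1, trG_apply]
  exact Equiv.sum_comp (MulAction.toPerm g) (fun x : G ⧸ P => conjEnd ρ (Quotient.out x) f)

/-- Conjugation invariance of the trace. -/
lemma trG_conj {ρ : Representation k G V} {P : Subgroup G} {f : V →ₗ[k] V}
    (hf : Eqv (resP ρ P) (resP ρ P) f) (g : G) (hg : ∀ u, u ∈ P ↔ g * u * g⁻¹ ∈ P) :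
    trG ρ P (conjEnd ρ g f) = trG ρ P f := by
  have := Fintype.ofFinite (G ⧸ P)
  rw [trG_apply, trG_apply]
  let E : G ⧸ P → G ⧸ P := fun x => ((Quotient.out x * g : G) : G ⧸ P)
  have hE : Function.Injective E := by
    intro x y h
    rw [QuotientGroup.eq] at h
    rw [← QuotientGroup.out_eq' x, ← QuotientGroup.out_eq' y, QuotientGroup.eq]
    rw [hg] at h
    convert h using 1
    group
  have hb := Finite.injective_iff_bijective.1 hE
  refine Fintype.sum_bijective E hb _ _ fun x => ?_
  rw [conj_out hf, conjEnd_mul]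

/-- Transitivity of the trace. -/
lemma trG_trans {ρ : Representation k G V} {P : Subgroup G} {Q : Subgroup ↥P} {f : V →ₗ[k] V}
    (hf : Eqv (resP ρ (Q.map P.subtype)) (resP ρ (Q.map P.subtype)) f) :
    trG ρ P (trG (resP ρ P) Q f) = trG ρ (Q.map P.subtype) f := by
  have hle : Q.map P.subtype ≤ P := Subgroup.map_subtype_le Q
  have hQ : (Q.map P.subtype).subgroupOf P = Q :=
    Subgroup.comap_map_eq_self_of_injective P.subtype_injective Q
  generalize Q.map P.subtype = R at *
  subst hQ
  have := Fintype.ofFinite (G ⧸ P)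
  have := Fintype.ofFinite (G ⧸ R)
  have := Fintype.ofFinite (↥P ⧸ R.subgroupOf P)
  rw [trG_apply ρ R, trG_apply ρ P, ← (Subgroup.quotientEquivProdOfLE hle).symm.sum_comp,
    Fintype.sum_prod_type]
  refine Finset.sum_congr rfl fun x _ => ?_
  ext v
  simp only [trG_apply, conjEnd_apply', LinearMap.sum_apply, map_sum]
  refine Finset.sum_congr rfl fun y _ => ?_
  have h1 : (Subgroup.quotientEquivProdOfLE hle).symm (x, y)
      = ((Quotient.out x * (Quotient.out y : ↥P) : G) : G ⧸ R) := by
    conv_lhs => rw [← QuotientGroup.out_eq' y]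
    rfl
  rw [← conjEnd_apply' ρ (Quotient.out ((Subgroup.quotientEquivProdOfLE hle).symm (x, y))), h1,
    conj_out hf, conjEnd_mul]
  rfl

lemma relProj_summand {ρ : Representation k G V} {σ : Representation k G W} {P : Subgroup G}
    {π : V →ₗ[k] W} {ι : W →ₗ[k] V} (hπ : Eqv ρ σ π) (hι : Eqv σ ρ ι)
    (h1 : π ∘ₗ ι = LinearMap.id) (h : RelProj ρ P) : RelProj σ P := by
  rw [relProj_iff] at h ⊢
  obtain ⟨f, hf, ht⟩ := h
  refine ⟨π ∘ₗ f ∘ₗ ι, ?_, ?_⟩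
  · exact Eqv.comp (σ := resP ρ P) (fun u x => hπ u x) (hf.comp (fun u x => hι u x))
  · rw [trG_natural P hπ hι, ht, LinearMap.id_comp, h1]

lemma relProj_top (ρ : Representation k G V) : RelProj ρ ⊤ := by
  rw [relProj_iff]
  refine ⟨LinearMap.id, Eqv.id _, ?_⟩
  have := Fintype.ofFinite (G ⧸ (⊤ : Subgroup G))
  have : Subsingleton (G ⧸ (⊤ : Subgroup G)) := QuotientGroup.subsingleton_quotient_top
  rw [trG_apply, Fintype.sum_subsingleton _ ((1 : G) : G ⧸ (⊤ : Subgroup G)), conj_out (Eqv.id _)]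
  ext v; simp [conjEnd_apply']

end T

section M
variable {k : Type*} [Field k] {G : Type*} [Group G] [Finite G]
variable {V : Type*} [AddCommGroup V] [Module k V] [Module.Finite k V]

/-- Mackey-type lemma. -/
lemma mackey {τ : Representation k G V} (h : RepIndecomposable τ)
    (hv : ∀ Q : Subgroup G, Q < ⊤ → ¬ RelProj τ Q)
    {X : Type*} [Fintype X] [MulAction G X] (φ : X → Module.End k V)
    (hφ : ∀ g x, φ (g • x) = conjEnd τ g (φ x))
    (hb : Function.Bijective (∑ x, φ x : Module.End k V)) :
    ∃ x, (∀ g : G, g • x = x) ∧ Function.Bijective (φ x) := by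
  classical
  have := Fintype.ofFinite (MulAction.orbitRel.Quotient G X)
  have hst : ∀ x, Eqv (resP τ (MulAction.stabilizer G x)) (resP τ (MulAction.stabilizer G x))
      (φ x) := by
    intro x
    rw [← inv_iff]
    intro u hu
    rw [← hφ, MulAction.mem_stabilizer_iff.1 hu]
  have hsum : (∑ x, φ x) = ∑ ω : MulAction.orbitRel.Quotient G X,
      trG τ (MulAction.stabilizer G ω.out) (φ ω.out) := by
    have hF : ∀ ω : MulAction.orbitRel.Quotient G X,
        Nonempty (Fintype (G ⧸ MulAction.stabilizer G ω.out)) := fun ω => ⟨Fintype.ofFinite _⟩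
    have := fun ω => (hF ω).some
    rw [← (MulAction.selfEquivSigmaOrbitsQuotientStabilizer G X).symm.sum_comp,
      Fintype.sum_sigma]
    refine Finset.sum_congr rfl fun ω _ => ?_
    rw [trG_apply]
    refine Finset.sum_congr rfl fun y _ => ?_
    rw [← hφ]
    congr 1
    conv_lhs => rw [← QuotientGroup.out_eq' y]
    rfl
  rw [hsum] at hb
  obtain ⟨ω, _, hω⟩ := local_sum h Finset.univ (fun ω _ => trG_eqv (hst ω.out)) hb
  have htop : MulAction.stabilizer G ω.out = ⊤ := by
    by_contra hne
    refine hv _ (lt_top_iff_ne_top.2 hne) ?_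
    rw [relProj_iff]
    obtain ⟨u, hu, hu1, -⟩ := exists_inv (trG_eqv (hst ω.out)) hω
    refine ⟨u ∘ₗ φ ω.out, ?_, ?_⟩
    · exact Eqv.comp (fun g x => hu g x) (hst ω.out)
    · rw [trG_comp_left _ hu]
      ext x; exact hu1 x
  have hfix : ∀ g : G, g • ω.out = ω.out := fun g => by
    have : g ∈ MulAction.stabilizer G ω.out := by rw [htop]; trivial
    exact this
  refine ⟨ω.out, hfix, ?_⟩
  have := Fintype.ofFinite (G ⧸ MulAction.stabilizer G ω.out)
  have hss : Subsingleton (G ⧸ MulAction.stabilizer G ω.out) := by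
    rw [htop]; exact QuotientGroup.subsingleton_quotient_top
  rw [trG_apply, Fintype.sum_subsingleton _ ((1 : G) : G ⧸ MulAction.stabilizer G ω.out),
    ← hφ, hfix] at hω
  exact hω

end M
section S
universe u
variable {k : Type*} [Field k] {G : Type*} [Group G] [Finite G]
variable {W : Type*} [AddCommGroup W] [Module k W] [Module.Finite k W]

lemma conj_iso {ρ : Representation k G W} {P : Subgroup G}
    {V : Type*} [AddCommGroup V] [Module k V] [Module.Finite k V]
    {X : Type*} [AddCommGroup X] [Module k X]
    {τ : Representation k ↥P V} (hV : RepIndecomposable τ)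
    (hv : ∀ Q : Subgroup ↥P, Q < ⊤ → ¬ RelProj τ Q)
    {i : V →ₗ[k] W} {q : W →ₗ[k] V} (hi : Eqv τ (resP ρ P) i) (hq : Eqv (resP ρ P) τ q)
    (hqi : q ∘ₗ i = LinearMap.id)
    {χ : Representation k ↥P X} (hX : RepIndecomposable χ)
    {a : X →ₗ[k] W} {b : W →ₗ[k] X} (ha : Eqv χ (resP ρ P) a) (hb : Eqv (resP ρ P) χ b)
    (ht : trG ρ P (a ∘ₗ b) = LinearMap.id) :
    ∃ g : G, (∀ u, u ∈ P ↔ g * u * g⁻¹ ∈ P) ∧ Function.Bijective (q ∘ₗ ρ g ∘ₗ a) := by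
  classical
  have := Fintype.ofFinite (G ⧸ P)
  have hab : Eqv (resP ρ P) (resP ρ P) (a ∘ₗ b) := ha.comp hb
  have hi' : ∀ (u : ↥P) x, i (τ u x) = ρ u (i x) := fun u x => hi u x
  have hq' : ∀ (u : ↥P) x, q (ρ u x) = τ u (q x) := fun u x => hq u x
  have ha' : ∀ (u : ↥P) x, a (χ u x) = ρ u (a x) := fun u x => ha u x
  have hb' : ∀ (u : ↥P) x, b (ρ u x) = χ u (b x) := fun u x => hb u x
  let φ : G ⧸ P → Module.End k V := fun x => q ∘ₗ conjEnd ρ (Quotient.out x) (a ∘ₗ b) ∘ₗ i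
  have hφ : ∀ (g : ↥P) (x : G ⧸ P), φ (g • x) = conjEnd τ g (φ x) := by
    intro g x
    have h1 : conjEnd ρ (Quotient.out (g • x)) (a ∘ₗ b)
        = conjEnd ρ ((g : G) * Quotient.out x) (a ∘ₗ b) := by
      apply conj_congr hab
      rw [QuotientGroup.out_eq']
      conv_lhs => rw [← QuotientGroup.out_eq' x]
      rfl
    ext v
    simp only [φ, h1, conjEnd_mul]
    rw [conjEnd_apply' τ]
    simp only [LinearMap.comp_apply]
    rw [conjEnd_apply' ρ (g : G), hq' g, hi' g⁻¹]
    rfl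
  have hsum : (∑ x, φ x) = LinearMap.id := by
    ext v
    have := LinearMap.congr_fun ht (i v)
    rw [trG_apply] at this
    simp only [LinearMap.sum_apply, LinearMap.id_apply] at this
    have h2 := congrArg q this
    rw [map_sum] at h2
    rw [LinearMap.sum_apply]
    refine Eq.trans ?_ (h2.trans (LinearMap.congr_fun hqi v))
    rfl
  obtain ⟨x, hx, hxb⟩ := mackey hV hv φ hφ (by rw [hsum]; exact Function.bijective_id)
  set g : G := Quotient.out x with hg
  have hgx : (g : G ⧸ P) = x := QuotientGroup.out_eq' x
  have hN : ∀ u, u ∈ P ↔ g * u * g⁻¹ ∈ P := by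
    have h1 : g⁻¹ ∈ Subgroup.normalizer (P : Set G) := by
      apply Subgroup.mem_normalizer_fintype
      intro n hn
      have h2 := hx ⟨n, hn⟩
      rw [← hgx] at h2
      have h3 : ((n * g : G) : G ⧸ P) = (g : G ⧸ P) := h2
      have h4 := QuotientGroup.eq.1 h3.symm
      simpa [mul_assoc] using h4
    have h2 := inv_mem h1
    rw [inv_inv] at h2
    intro u
    exact h2 u
  refine ⟨g, hN, ?_⟩
  have hce : Eqv τ τ (φ x) := by
    intro u y
    have h1 := hφ u x
    rw [hx u] at h1
    have h2 := LinearMap.congr_fun h1 (τ u y)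
    rw [conjEnd_apply', rep_inv_self] at h2
    exact h2
  obtain ⟨c, hc, hc1, hc2⟩ := exists_inv hce hxb
  have hc2' : ∀ y, q (ρ g (a (b (ρ g⁻¹ (i (c y)))))) = y := hc2
  have hsurj : Function.Surjective (q ∘ₗ ρ g ∘ₗ a) := fun y => ⟨_, hc2' y⟩
  let κ : X →ₗ[k] X := (b ∘ₗ ρ g⁻¹ ∘ₗ i ∘ₗ c) ∘ₗ (q ∘ₗ ρ g ∘ₗ a)
  have hκ : Eqv χ χ κ := by
    intro u y
    have hu : g * u * g⁻¹ ∈ P := (hN u).1 u.2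
    have e1 : ρ g (ρ u (a y)) = ρ (⟨g * u * g⁻¹, hu⟩ : ↥P) (ρ g (a y)) := by
      rw [← rep_mul, ← rep_mul]; simp
    have e2 : ∀ w, ρ g⁻¹ (ρ (⟨g * u * g⁻¹, hu⟩ : ↥P) w) = ρ u (ρ g⁻¹ w) := by
      intro w
      rw [← rep_mul, ← rep_mul]; congr 2; simp [mul_assoc]
    simp only [κ, LinearMap.comp_apply]
    rw [ha', e1, hq', hc, hi', e2, hb']
  have hκi : κ ∘ₗ κ = κ := by
    ext y
    simp only [κ, LinearMap.comp_apply]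
    rw [hc2']
  rcases indec_idem hX hκ hκi with h0 | h0
  · exfalso
    have := hV.1
    obtain ⟨y, hy⟩ := exists_ne (0 : V)
    obtain ⟨z, rfl⟩ := hsurj y
    apply hy
    have h1 := LinearMap.congr_fun h0 z
    simp only [κ, LinearMap.comp_apply, LinearMap.zero_apply] at h1
    have h2 := hc2' (q (ρ g (a z)))
    rw [h1] at h2
    simp only [map_zero] at h2
    exact h2.symm
  · refine ⟨?_, hsurj⟩
    intro y z hyz
    have h1 : κ y = κ z := by
      simp only [κ]
      rw [LinearMap.comp_apply, hyz]; rfl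
    rw [h0] at h1
    exact h1

lemma exists_src_aux {ρ : Representation k G W} (hW : RepIndecomposable ρ) {P : Subgroup G}
    (n : ℕ) : ∀ (X : Type u) [AddCommGroup X] [Module k X] [Module.Finite k X]
    (_ : Module.finrank k X = n) (χ : Representation k ↥P X)
    (i a : X →ₗ[k] W) (q : W →ₗ[k] X) (_ : Eqv χ (resP ρ P) i) (_ : Eqv χ (resP ρ P) a)
    (_ : Eqv (resP ρ P) χ q) (_ : q ∘ₗ i = LinearMap.id)
    (_ : Function.Bijective (trG ρ P (a ∘ₗ q))),
    ∃ (X : Type u) (_ : AddCommGroup X) (_ : Module k X) (_ : Module.Finite k X)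
      (χ : Representation k ↥P X) (i a : X →ₗ[k] W) (q : W →ₗ[k] X),
      RepIndecomposable χ ∧ Eqv χ (resP ρ P) i ∧ Eqv χ (resP ρ P) a ∧ Eqv (resP ρ P) χ q ∧
      q ∘ₗ i = LinearMap.id ∧ trG ρ P (a ∘ₗ q) = LinearMap.id := by
  induction n using Nat.strong_induction_on with
  | _ n ih =>
  intro X _ _ _ hn χ i a q hi ha hq hqi hb
  by_cases hX : RepIndecomposable χ
  · obtain ⟨c, hc, hc1, hc2⟩ := exists_inv (trG_eqv (ha.comp hq)) hb
    refine ⟨X, _, _, ‹_›, χ, i, c ∘ₗ a, q, hX, hi, ?_, hq, hqi, ?_⟩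
    · exact Eqv.comp (σ := resP ρ P) (fun g x => hc g x) ha
    · rw [LinearMap.comp_assoc, trG_comp_left P hc]
      ext x; exact hc1 x
  · have hnt : Nontrivial X := by
      by_contra hcon
      rw [not_nontrivial_iff_subsingleton] at hcon
      have hz : a ∘ₗ q = 0 := by
        ext x; simp [Subsingleton.elim (q x) 0]
      rw [hz, trG_zero] at hb
      have := hW.1
      obtain ⟨y, hy⟩ := exists_ne (0 : W)
      exact hy (hb.1 (by simp))
    have key : ∃ N₁ N₂ : Submodule k X, RepStable χ N₁ ∧ RepStable χ N₂ ∧ IsCompl N₁ N₂ ∧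
        N₁ ≠ ⊥ ∧ N₂ ≠ ⊥ := by
      by_contra hcon
      apply hX
      refine ⟨hnt, fun N₁ N₂ h1 h2 h3 => ?_⟩
      by_contra h4
      rw [not_or] at h4
      exact hcon ⟨N₁, N₂, h1, h2, h3, h4.1, h4.2⟩
    obtain ⟨N₁, N₂, h1, h2, hc, hn1, hn2⟩ := key
    -- the step for a single summand
    have step : ∀ N N' : Submodule k X, RepStable χ N → RepStable χ N' → ∀ h : IsCompl N N',
        N' ≠ ⊥ → Function.Bijective (trG ρ P (a ∘ₗ (N.projection N' h) ∘ₗ q)) →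
        ∃ (X : Type u) (_ : AddCommGroup X) (_ : Module k X) (_ : Module.Finite k X)
        (χ : Representation k ↥P X) (i a : X →ₗ[k] W) (q : W →ₗ[k] X),
        RepIndecomposable χ ∧ Eqv χ (resP ρ P) i ∧ Eqv χ (resP ρ P) a ∧ Eqv (resP ρ P) χ q ∧
        q ∘ₗ i = LinearMap.id ∧ trG ρ P (a ∘ₗ q) = LinearMap.id := by
      intro N N' hN hN' h hne hbij
      let χN : Representation k ↥P N :=
        { toFun := fun u => (χ u).restrict (hN u)
          map_one' := by ext x; simp
          map_mul' := fun u v => by ext x; simp }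
      have hlt : Module.finrank k N < n := by
        rw [← hn]
        apply Submodule.finrank_lt
        rintro rfl
        exact hne (by simpa using h.inf_eq_bot)
      have hsub : Eqv χN χ N.subtype := fun u x => rfl
      let pr : X →ₗ[k] N := N.projectionOnto N' h
      have hpr1 : ∀ x : N, pr x = x := fun x => Submodule.projectionOnto_apply_left h x
      have hpr2 : ∀ x ∈ N', pr x = 0 := fun x hx =>
        (Submodule.projectionOnto_apply_eq_zero_iff h).2 hx
      have hpr : Eqv χ χN pr := by
        intro g x
        obtain ⟨y, hy, z, hz, rfl⟩ : ∃ y ∈ N, ∃ z ∈ N', y + z = x :=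
          Submodule.mem_sup.1 (by rw [h.sup_eq_top]; trivial)
        have e1 := hpr1 ⟨y, hy⟩
        have e2 := hpr1 ⟨χ g y, hN g y hy⟩
        simp only [map_add]
        simp only at e1 e2
        rw [hpr2 z hz, hpr2 _ (hN' g z hz), e1, e2]
        simp only [map_zero, add_zero]
        rfl
      refine ih _ hlt N rfl χN (i ∘ₗ N.subtype) (a ∘ₗ N.subtype) (pr ∘ₗ q)
        (hi.comp hsub) (ha.comp hsub) (hpr.comp hq) ?_ ?_
      · ext x
        have := LinearMap.congr_fun hqi (x : X)
        simp only [LinearMap.comp_apply, LinearMap.id_apply] at this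
        simp only [LinearMap.comp_apply, Submodule.subtype_apply, this, hpr1, LinearMap.id_apply]
      · exact hbij
    have hproj : ∀ N N' : Submodule k X, RepStable χ N → RepStable χ N' → ∀ h : IsCompl N N',
        Eqv χ χ (N.projection N' h) := by
      intro N N' hN hN' h g x
      obtain ⟨y, hy, z, hz, rfl⟩ : ∃ y ∈ N, ∃ z ∈ N', y + z = x :=
        Submodule.mem_sup.1 (by rw [h.sup_eq_top]; trivial)
      have e1 : ∀ x ∈ N, N.projection N' h x = x := fun x hx => by
        simpa using Submodule.projection_apply_left h ⟨x, hx⟩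
      have e2 : ∀ x ∈ N', N.projection N' h x = 0 := fun x hx => by simpa using hx
      simp only [map_add]
      rw [e1 y hy, e2 z hz, e1 _ (hN g y hy), e2 _ (hN' g z hz)]; simp
    have hsum : a ∘ₗ q = a ∘ₗ (N₁.projection N₂ hc) ∘ₗ q + a ∘ₗ (N₂.projection N₁ hc.symm) ∘ₗ q := by
      ext w
      simp only [LinearMap.add_apply, LinearMap.comp_apply, ← map_add]
      congr 1
      exact (Submodule.projection_add_projection_eq_self hc (q w)).symm
    rw [hsum, trG_add] at hb
    rcases local_add hW (trG_eqv (ha.comp ((hproj N₁ N₂ h1 h2 hc).comp hq)))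
      (trG_eqv (ha.comp ((hproj N₂ N₁ h2 h1 hc.symm).comp hq))) hb with h3 | h3
    · exact step N₁ N₂ h1 h2 hc hn2 h3
    · exact step N₂ N₁ h2 h1 hc.symm hn1 h3

lemma exists_src {W : Type u} [AddCommGroup W] [Module k W] [Module.Finite k W]
    {ρ : Representation k G W} (hW : RepIndecomposable ρ) {P : Subgroup G}
    (hP : RelProj ρ P) :
    ∃ (X : Type u) (_ : AddCommGroup X) (_ : Module k X) (_ : Module.Finite k X)
      (χ : Representation k ↥P X) (i a : X →ₗ[k] W) (q : W →ₗ[k] X),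
      RepIndecomposable χ ∧ Eqv χ (resP ρ P) i ∧ Eqv χ (resP ρ P) a ∧ Eqv (resP ρ P) χ q ∧
      q ∘ₗ i = LinearMap.id ∧ trG ρ P (a ∘ₗ q) = LinearMap.id := by
  rw [relProj_iff] at hP
  obtain ⟨f, hf, ht⟩ := hP
  exact exists_src_aux hW _ W rfl (resP ρ P) LinearMap.id f LinearMap.id (Eqv.id _) hf (Eqv.id _)
    rfl (by rw [LinearMap.comp_id, ht]; exact Function.bijective_id)

lemma relProj_lift {ρ : Representation k G W} {P : Subgroup G}
    {X : Type*} [AddCommGroup X] [Module k X] {χ : Representation k ↥P X}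
    {a : X →ₗ[k] W} {q : W →ₗ[k] X} (ha : Eqv χ (resP ρ P) a) (hq : Eqv (resP ρ P) χ q)
    (ht : trG ρ P (a ∘ₗ q) = LinearMap.id) {Q : Subgroup ↥P} (hQ : RelProj χ Q) :
    RelProj ρ (Q.map P.subtype) := by
  rw [relProj_iff] at hQ ⊢
  obtain ⟨h, hh, h1⟩ := hQ
  have hE : Eqv (resP ρ (Q.map P.subtype)) (resP ρ (Q.map P.subtype)) (a ∘ₗ h ∘ₗ q) := by
    rintro ⟨_, u, hu, rfl⟩ x
    have e1 := hq u x
    have e2 := hh ⟨u, hu⟩ (q x)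
    have e3 := ha u (h (q x))
    simp only [MonoidHom.comp_apply, Subgroup.subtype_apply, LinearMap.comp_apply] at e1 e2 e3 ⊢
    rw [e1, e2, e3]
  refine ⟨_, hE, ?_⟩
  rw [← trG_trans hE, trG_natural Q ha hq, h1]
  exact ht

end S
section B
variable {k k' : Type*} [Field k] [Field k'] [Algebra k k']
variable {G : Type*} [Group G]
variable {M : Type*} [AddCommGroup M] [Module k M]
variable {N : Type*} [AddCommGroup N] [Module k N]
variable {L : Type*} [AddCommGroup L] [Module k L]

/-- Coefficient of a linear map of scalar extensions with respect to a functional. -/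
def coef (l : k' →ₗ[k] k) (F : (k' ⊗[k] M) →ₗ[k'] (k' ⊗[k] N)) : M →ₗ[k] N :=
  (TensorProduct.lid k N).toLinearMap ∘ₗ l.rTensor N ∘ₗ F.restrictScalars k ∘ₗ
    TensorProduct.mk k k' M 1

lemma coef_apply (l : k' →ₗ[k] k) (F : (k' ⊗[k] M) →ₗ[k'] (k' ⊗[k] N)) (m : M) :
    coef l F m = TensorProduct.lid k N (l.rTensor N (F (1 ⊗ₜ m))) := rfl

lemma coef_sum {ι : Type*} (s : Finset ι) (l : k' →ₗ[k] k)
    (F : ι → (k' ⊗[k] M) →ₗ[k'] (k' ⊗[k] N)) :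
    coef l (∑ i ∈ s, F i) = ∑ i ∈ s, coef l (F i) := by
  ext m
  simp [coef_apply, LinearMap.sum_apply, map_sum]

lemma coef_baseChange (l : k' →ₗ[k] k) (f : M →ₗ[k] N) :
    coef l (f.baseChange k') = l 1 • f := by
  ext m; simp [coef_apply]

lemma coef_comp_bc (l : k' →ₗ[k] k) (F : (k' ⊗[k] N) →ₗ[k'] (k' ⊗[k] L)) (f : M →ₗ[k] N) :
    coef l (F ∘ₗ f.baseChange k') = coef l F ∘ₗ f := by
  ext m; simp [coef_apply]

lemma coef_bc_comp (l : k' →ₗ[k] k) (F : (k' ⊗[k] M) →ₗ[k'] (k' ⊗[k] N)) (f : N →ₗ[k] L) :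
    coef l (f.baseChange k' ∘ₗ F) = f ∘ₗ coef l F := by
  ext m
  simp only [coef_apply, LinearMap.comp_apply]
  generalize F (1 ⊗ₜ m) = x
  induction x with
  | zero => simp
  | tmul c n => simp
  | add x y hx hy => simp only [map_add, hx, hy]

lemma exists_retr (k k' : Type*) [Field k] [Field k'] [Algebra k k'] :
    ∃ l : k' →ₗ[k] k, l 1 = 1 := by
  obtain ⟨l, hl⟩ := LinearMap.exists_leftInverse_of_injective (Algebra.linearMap k k')
    (LinearMap.ker_eq_bot.2 (algebraMap k k').injective)
  refine ⟨l, ?_⟩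
  have := LinearMap.congr_fun hl 1
  simpa using this

lemma bc_injective : Function.Injective
    (fun f : M →ₗ[k] N => f.baseChange k') := by
  intro f g h
  obtain ⟨l, hl⟩ := exists_retr k k'
  have := congrArg (coef l) h
  simpa [coef_baseChange, hl] using this

lemma coef_expand [Module.Finite k M] {ι : Type*} (b : Module.Basis ι k k')
    (F : (k' ⊗[k] M) →ₗ[k'] (k' ⊗[k] N)) :
    ∃ s : Finset ι, F = ∑ i ∈ s, b i • (coef (b.coord i) F).baseChange k' := by
  classical
  let Ψ : M →ₗ[k] (ι →₀ N) := (TensorProduct.equivFinsuppOfBasisLeft b).toLinearMap ∘ₗ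
    F.restrictScalars k ∘ₗ TensorProduct.mk k k' M 1
  have hΨ : ∀ m i, Ψ m i = coef (b.coord i) F m := fun m i =>
    TensorProduct.equivFinsuppOfBasisLeft_apply b _ i
  obtain ⟨t, ht⟩ := (Module.Finite.fg_top : (⊤ : Submodule k M).FG)
  let s : Finset ι := t.biUnion fun m => (Ψ m).support
  have hs : ∀ m, Ψ m ∈ Finsupp.supported N k (s : Set ι) := by
    intro m
    have : (⊤ : Submodule k M) ≤ (Finsupp.supported N k (s : Set ι)).comap Ψ := by
      rw [← ht, Submodule.span_le]
      intro m hm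
      simp only [Submodule.comap_coe, Set.mem_preimage, SetLike.mem_coe, Finsupp.mem_supported]
      intro i hi
      simp only [s, Finset.coe_biUnion, Set.mem_iUnion]
      exact ⟨m, hm, hi⟩
    exact this trivial
  refine ⟨s, ?_⟩
  ext m
  simp only [TensorProduct.AlgebraTensorModule.curry_apply, LinearMap.restrictScalars_self,
    TensorProduct.curry_apply, LinearMap.coe_restrictScalars, LinearMap.sum_apply,
    LinearMap.smul_apply, LinearMap.baseChange_tmul, TensorProduct.smul_tmul', smul_eq_mul, mul_one]
  have h1 : F (1 ⊗ₜ m) = (TensorProduct.equivFinsuppOfBasisLeft b).symm (Ψ m) := by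
    simp [Ψ]
  rw [h1, TensorProduct.equivFinsuppOfBasisLeft_symm_apply, Finsupp.sum_of_support_subset (s := s)]
  · simp only [hΨ]
  · exact_mod_cast hs m
  · simp

/-- Compatibility of a representation with scalar extension. -/
def Compat (ρ : Representation k G M) (ρ' : Representation k' G (k' ⊗[k] M)) : Prop :=
  ∀ g, ρ' g = (ρ g).baseChange k'

lemma coef_eqv {ρ : Representation k G M} {ρ' : Representation k' G (k' ⊗[k] M)}
    {σ : Representation k G N} {σ' : Representation k' G (k' ⊗[k] N)}
    (hρ : Compat ρ ρ') (hσ : Compat σ σ') (l : k' →ₗ[k] k)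
    {F : (k' ⊗[k] M) →ₗ[k'] (k' ⊗[k] N)} (hF : Eqv ρ' σ' F) : Eqv ρ σ (coef l F) := by
  intro g x
  have h1 : F ∘ₗ (ρ g).baseChange k' = (σ g).baseChange k' ∘ₗ F := by
    rw [← hρ, ← hσ]; ext x; exact hF g _
  have h2 := congrArg (coef l) h1
  rw [coef_comp_bc, coef_bc_comp] at h2
  exact LinearMap.congr_fun h2 x

lemma bc_eqv {ρ : Representation k G M} {ρ' : Representation k' G (k' ⊗[k] M)}
    {σ : Representation k G N} {σ' : Representation k' G (k' ⊗[k] N)}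
    (hρ : Compat ρ ρ') (hσ : Compat σ σ') {f : M →ₗ[k] N} (hf : Eqv ρ σ f) :
    Eqv ρ' σ' (f.baseChange k') := by
  intro g x
  have h1 : f ∘ₗ ρ g = σ g ∘ₗ f := by ext x; exact hf g x
  rw [hρ, hσ, ← LinearMap.comp_apply, ← LinearMap.comp_apply, ← LinearMap.baseChange_comp,
    ← LinearMap.baseChange_comp, h1]

lemma conj_bc {ρ : Representation k G M} {ρ' : Representation k' G (k' ⊗[k] M)}
    (hρ : Compat ρ ρ') (g : G) (f : M →ₗ[k] M) :
    conjEnd ρ' g (f.baseChange k') = (conjEnd ρ g f).baseChange k' := by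
  unfold conjEnd
  rw [hρ, hρ, LinearMap.baseChange_comp, LinearMap.baseChange_comp]

lemma bc_indec {ρ : Representation k G M} {ρ' : Representation k' G (k' ⊗[k] M)}
    (hρ : Compat ρ ρ') (h : RepIndecomposable ρ') : RepIndecomposable ρ := by
  refine indec_of_idem ?_ fun f hf hi => ?_
  · by_contra hcon
    rw [not_nontrivial_iff_subsingleton] at hcon
    have h1 := h.1
    exact not_subsingleton (k' ⊗[k] M) inferInstance
  · rcases indec_idem h (bc_eqv hρ hρ hf) (by rw [← LinearMap.baseChange_comp, hi]) with h0 | h0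
    · left; apply bc_injective (k' := k'); simpa using h0
    · right; apply bc_injective (k' := k'); simpa using h0

variable [Finite G]

lemma trG_bc {ρ : Representation k G M} {ρ' : Representation k' G (k' ⊗[k] M)}
    (hρ : Compat ρ ρ') (P : Subgroup G) (f : M →ₗ[k] M) :
    trG ρ' P (f.baseChange k') = (trG ρ P f).baseChange k' := by
  have := Fintype.ofFinite (G ⧸ P)
  rw [trG_apply, trG_apply]
  simp only [conj_bc hρ]
  exact (map_sum (LinearMap.baseChangeHom k k' M M) _ _).symm

lemma relProj_bc {ρ : Representation k G M} {ρ' : Representation k' G (k' ⊗[k] M)}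
    (hρ : Compat ρ ρ') {P : Subgroup G} (h : RelProj ρ P) : RelProj ρ' P := by
  rw [relProj_iff] at h ⊢
  obtain ⟨f, hf, ht⟩ := h
  refine ⟨f.baseChange k', bc_eqv (ρ := resP ρ P) (σ := resP ρ P) (ρ' := resP ρ' P)
    (σ' := resP ρ' P) (fun g => hρ g) (fun g => hρ g) hf, ?_⟩
  rw [trG_bc hρ, ht]; simp

lemma coef_trG {ρ : Representation k G M} {ρ' : Representation k' G (k' ⊗[k] M)}
    (hρ : Compat ρ ρ') (P : Subgroup G) (l : k' →ₗ[k] k)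
    (F : (k' ⊗[k] M) →ₗ[k'] (k' ⊗[k] M)) :
    coef l (trG ρ' P F) = trG ρ P (coef l F) := by
  have := Fintype.ofFinite (G ⧸ P)
  rw [trG_apply, trG_apply, coef_sum]
  refine Finset.sum_congr rfl fun x _ => ?_
  unfold conjEnd
  rw [hρ, hρ, coef_bc_comp, coef_comp_bc]

variable [Module.Finite k M]


lemma nilp_bc {ρ : Representation k G M} {J : Ideal (endAlg ρ)} (hJ : IsNilpotent J)
    {F : Module.End k' (k' ⊗[k] M)}
    (hF : F ∈ Submodule.span k' ((fun f : endAlg ρ =>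
      (((f : Module.End k M)).baseChange k' : Module.End k' (k' ⊗[k] M))) '' (J : Set (endAlg ρ)))) :
    IsNilpotent F := by
  set Φ : endAlg ρ → Module.End k' (k' ⊗[k] M) :=
    fun f => (f : Module.End k M).baseChange k' with hΦ
  obtain ⟨n, hn⟩ := hJ
  have key : ∀ m, F ^ (m + 1) ∈ Submodule.span k' (Φ '' ((J ^ (m + 1) : Ideal (endAlg ρ)) : Set _)) := by
    intro m
    induction m with
    | zero => rw [zero_add, pow_one, Submodule.pow_one]; exact hF
    | succ m ih =>
      rw [pow_succ F]
      have h1 := Submodule.mul_mem_mul ih hF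
      rw [Submodule.span_mul_span] at h1
      refine Submodule.span_mono ?_ h1
      rintro _ ⟨_, ⟨x, hx, rfl⟩, _, ⟨y, hy, rfl⟩, rfl⟩
      refine ⟨x * y, ?_, ?_⟩
      · rw [Submodule.pow_succ J]; exact Submodule.mul_mem_mul hx hy
      · simp only [hΦ]
        exact LinearMap.baseChange_comp _ _
  refine ⟨n + 1, ?_⟩
  have h2 := key n
  rw [Submodule.pow_succ J, hn] at h2
  have h3 : Submodule.span k' (Φ '' (((0 : Ideal (endAlg ρ)) * J : Ideal (endAlg ρ)) : Set _)) ≤ ⊥ := by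
    rw [Submodule.span_le]
    rintro _ ⟨x, hx, rfl⟩
    have hx0 : ((0 : Ideal (endAlg ρ)) * J : Ideal (endAlg ρ)) = ⊥ := Submodule.bot_mul J
    rw [hx0] at hx
    have : x = 0 := hx
    subst this
    simp [hΦ]
  simpa using h3 h2

lemma vertex_descent {ρ : Representation k G M} {ρ' : Representation k' G (k' ⊗[k] M)}
    (hρ : Compat ρ ρ') (hM : RepIndecomposable ρ)
    {W : Type*} [AddCommGroup W] [Module k' W] {σ : Representation k' G W} (hW : Nontrivial W)
    {π : (k' ⊗[k] M) →ₗ[k'] W} {ι : W →ₗ[k'] (k' ⊗[k] M)} (hπ : Eqv ρ' σ π) (hι : Eqv σ ρ' ι)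
    (hπι : π ∘ₗ ι = LinearMap.id) {Q : Subgroup G} (hQ : RelProj σ Q) : RelProj ρ Q := by
  rw [relProj_iff] at hQ
  obtain ⟨h, hh, ht⟩ := hQ
  have hπι' : ∀ x, π (ι x) = x := LinearMap.congr_fun hπι
  set E : Module.End k' (k' ⊗[k] M) := ι ∘ₗ π with hE
  set H := ι ∘ₗ h ∘ₗ π with hH
  have hHe : Eqv (resP ρ' Q) (resP ρ' Q) H :=
    Eqv.comp (σ := resP σ Q) (fun g x => hι g x) (hh.comp fun g x => hπ g x)
  have hEt : trG ρ' Q H = E := by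
    rw [hH, trG_natural Q hι hπ, ht]; rfl
  let b := Module.Basis.ofVectorSpace k k'
  obtain ⟨s, hs⟩ := coef_expand b E
  have hc : ∀ l : k' →ₗ[k] k, coef l E = trG ρ Q (coef l H) := fun l => by
    rw [← hEt, coef_trG hρ]
  have hce : ∀ l : k' →ₗ[k] k, Eqv (resP ρ Q) (resP ρ Q) (coef l H) := fun l =>
    coef_eqv (ρ := resP ρ Q) (σ := resP ρ Q) (ρ' := resP ρ' Q) (σ' := resP ρ' Q)
      (fun g => hρ g) (fun g => hρ g) l hHe
  by_cases hex : ∃ i, Function.Bijective (coef (b.coord i) E)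
  · obtain ⟨i, hi⟩ := hex
    rw [hc] at hi
    obtain ⟨c, hc', hc1, -⟩ := exists_inv (trG_eqv (hce _)) hi
    rw [relProj_iff]
    refine ⟨c ∘ₗ coef (b.coord i) H, ?_, ?_⟩
    · exact Eqv.comp (σ := resP ρ Q) (fun g x => hc' g x) (hce _)
    · rw [trG_comp_left Q hc']
      ext x; exact hc1 x
  · exfalso
    obtain ⟨J, hJ, hJm⟩ := rad_nilp hM
    have hnil : IsNilpotent E := by
      refine nilp_bc hJ ?_
      rw [hs]
      refine Submodule.sum_mem _ fun i _ => Submodule.smul_mem _ _ (Submodule.subset_span ?_)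
      have hmem : Eqv ρ ρ (coef (b.coord i) E) := by rw [hc]; exact trG_eqv (hce _)
      exact ⟨⟨_, hmem⟩, hJm ⟨_, hmem⟩ (fun hb => hex ⟨i, hb⟩), rfl⟩
    have hidem : IsIdempotentElem E := by
      ext x
      simp [hE, hπι']
    obtain ⟨n, hn⟩ := hnil
    have hE0 : E = 0 := by
      have := hidem.pow_succ_eq n
      rw [pow_succ, hn, zero_mul] at this
      exact this.symm
    obtain ⟨w, hw⟩ := exists_ne (0 : W)
    apply hw
    have h1 := LinearMap.congr_fun hE0 (ι w)
    simp only [hE, LinearMap.comp_apply, hπι', LinearMap.zero_apply] at h1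
    rw [← hπι' w, h1, map_zero]

end B
section N
variable {k k' : Type*} [Field k] [Field k'] [Algebra k k']
variable {G : Type*} [Group G]
variable {M : Type*} [AddCommGroup M] [Module k M]
variable {V : Type*} [AddCommGroup V] [Module k V] [Module.Finite k V]

/-- Descent of direct summands. -/
lemma summand_descent {ρ : Representation k G M} {ρ' : Representation k' G (k' ⊗[k] M)}
    {τ : Representation k G V} {τ' : Representation k' G (k' ⊗[k] V)}
    (hρ : Compat ρ ρ') (hτ : Compat τ τ') (hV : RepIndecomposable τ)
    {π : (k' ⊗[k] M) →ₗ[k'] (k' ⊗[k] V)} {ι : (k' ⊗[k] V) →ₗ[k'] (k' ⊗[k] M)}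
    (hπ : Eqv ρ' τ' π) (hι : Eqv τ' ρ' ι) (hπι : π ∘ₗ ι = LinearMap.id) :
    ∃ (q : M →ₗ[k] V) (i : V →ₗ[k] M), Eqv ρ τ q ∧ Eqv τ ρ i ∧ q ∘ₗ i = LinearMap.id := by
  let b := Module.Basis.ofVectorSpace k k'
  obtain ⟨s, hs⟩ := coef_expand b ι
  obtain ⟨l, hl⟩ := exists_retr k k'
  have hsm : ∀ c : k', Eqv ρ' τ' (c • π) := fun c g x => by simp [hπ g x]
  have hid : (∑ j ∈ s, coef l (b j • π) ∘ₗ coef (b.coord j) ι) = LinearMap.id := by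
    have h1 : coef l (π ∘ₗ ι) = LinearMap.id := by
      rw [hπι, ← LinearMap.baseChange_id, coef_baseChange, hl, one_smul]
    rw [← h1]
    have h2 : π ∘ₗ ι = ∑ j ∈ s, π ∘ₗ (b j • (coef (b.coord j) ι).baseChange k') := by
      conv_lhs => rw [hs]
      apply LinearMap.ext
      intro x
      simp only [LinearMap.comp_apply, LinearMap.sum_apply, map_sum]
    rw [h2, coef_sum]
    refine Finset.sum_congr rfl fun j _ => ?_
    rw [← coef_comp_bc]
    congr 1
    rw [LinearMap.comp_smul, LinearMap.smul_comp]
  have he : ∀ j, Eqv τ τ (coef l (b j • π) ∘ₗ coef (b.coord j) ι) := fun j =>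
    (coef_eqv hρ hτ l (hsm _)).comp (coef_eqv hτ hρ _ hι)
  obtain ⟨j, -, hj⟩ := local_sum hV s (fun j _ => he j)
    (by rw [hid]; exact Function.bijective_id)
  obtain ⟨c, hc, hc1, -⟩ := exists_inv (he j) hj
  refine ⟨c ∘ₗ coef l (b j • π), coef (b.coord j) ι, hc.comp (coef_eqv hρ hτ l (hsm _)),
    coef_eqv hτ hρ _ hι, ?_⟩
  ext x; exact hc1 x

end N


lemma ind_from_source {k : Type*} [Field k] {G : Type*} [Group G] [Finite G]
    {M : Type*} [AddCommGroup M] [Module k M] [Module.Finite k M]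
    {V : Type*} [AddCommGroup V] [Module k V] [Module.Finite k V]
    {ρ : Representation k G M} (hind : RepIndecomposable ρ) {P : Subgroup G} (hP : RelProj ρ P)
    {τ : Representation k ↥P V} (hτi : RepIndecomposable τ)
    (hτv : ∀ Q : Subgroup ↥P, Q < ⊤ → ¬ RelProj τ Q)
    {q : M →ₗ[k] V} {i : V →ₗ[k] M} (hq : Eqv (resP ρ P) τ q) (hi : Eqv τ (resP ρ P) i)
    (hqi : q ∘ₗ i = LinearMap.id) :
    ∃ (a : V →ₗ[k] M) (b : M →ₗ[k] V), Eqv τ (resP ρ P) a ∧ Eqv (resP ρ P) τ b ∧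
      trG ρ P (a ∘ₗ b) = LinearMap.id := by
  obtain ⟨X, _, _, _, χ, iX, aX, qX, hX, hiX, haX, hqX, -, htX⟩ := exists_src hind hP
  obtain ⟨g, hg, hgb⟩ := conj_iso hτi hτv hi hq hqi hX haX hqX htX
  obtain ⟨θ, hθ'⟩ : ∃ θ : X ≃ₗ[k] V, ∀ x, θ x = q (ρ g (aX x)) :=
    ⟨LinearEquiv.ofBijective (q ∘ₗ ρ g ∘ₗ aX) hgb, fun x => rfl⟩
  have hθ : ∀ (u : ↥P) x, θ (χ u x) = τ ⟨g * u * g⁻¹, (hg u).1 u.2⟩ (θ x) := by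
    intro u x
    have e1 : aX (χ u x) = ρ u (aX x) := haX u x
    have e2 := hq ⟨g * u * g⁻¹, (hg u).1 u.2⟩ (ρ g (aX x))
    rw [hθ', hθ', e1, ← e2]
    congr 1
    change _ = ρ (g * u * g⁻¹) (ρ g (aX x))
    rw [← rep_mul, ← rep_mul]; simp
  have hgi : ∀ u : ↥P, g⁻¹ * u * g ∈ P := fun u => by
    rw [hg]; simp [mul_assoc]
  have hθs : ∀ (u : ↥P) y, θ (χ ⟨g⁻¹ * u * g, hgi u⟩ y) = τ u (θ y) := by
    intro u y
    rw [hθ]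
    congr 2
    ext; simp [mul_assoc]
  have hB : Eqv (resP ρ P) τ (θ.toLinearMap ∘ₗ qX ∘ₗ ρ g⁻¹) := by
    intro u m
    have e1 := hqX ⟨g⁻¹ * u * g, hgi u⟩ (ρ g⁻¹ m)
    have e2 : ρ g⁻¹ (ρ u m) = ρ (g⁻¹ * u * g) (ρ g⁻¹ m) := by
      rw [← rep_mul, ← rep_mul]; simp [mul_assoc]
    change θ (qX (ρ g⁻¹ (ρ u m))) = τ u (θ (qX (ρ g⁻¹ m)))
    rw [e2, ← hθs]
    exact congrArg θ e1
  have hA : Eqv τ (resP ρ P) (ρ g ∘ₗ aX ∘ₗ θ.symm.toLinearMap) := by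
    intro u y
    obtain ⟨x, rfl⟩ := θ.surjective y
    have e1 := haX ⟨g⁻¹ * u * g, hgi u⟩ x
    change ρ g (aX (θ.symm (τ u (θ x)))) = ρ u (ρ g (aX (θ.symm (θ x))))
    rw [← hθs, θ.symm_apply_apply, θ.symm_apply_apply]
    refine (congrArg (ρ g) e1).trans ?_
    change ρ g (ρ (g⁻¹ * u * g) (aX x)) = _
    rw [← rep_mul, ← rep_mul]; simp [mul_assoc]
  refine ⟨_, _, hA, hB, ?_⟩
  rw [← htX, ← trG_conj (haX.comp hqX) g hg]
  congr 1
  ext m; simp [conjEnd_apply']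

lemma source_of_ind {k : Type*} [Field k] {G : Type*} [Group G] [Finite G]
    {W : Type*} [AddCommGroup W] [Module k W] [Module.Finite k W]
    {V' : Type*} [AddCommGroup V'] [Module k V']
    {σ₂ : Representation k G W} (hWi : RepIndecomposable σ₂) {P : Subgroup G}
    (hWP : RelProj σ₂ P) (hWv : ∀ Q : Subgroup G, Q < P → ¬ RelProj σ₂ Q)
    {σV' : Representation k ↥P V'} (hVi : RepIndecomposable σV')
    {A : V' →ₗ[k] W} {B : W →ₗ[k] V'} (hA : Eqv σV' (resP σ₂ P) A)
    (hB : Eqv (resP σ₂ P) σV' B) (hAB : trG σ₂ P (A ∘ₗ B) = LinearMap.id) :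
    IsRepSummand (σ₂.comp P.subtype) σV' := by
  obtain ⟨X, _, _, _, χ, iX, aX, qX, hX, hiX, haX, hqX, hqiX, htX⟩ := exists_src hWi hWP
  have hXv : ∀ Q : Subgroup ↥P, Q < ⊤ → ¬ RelProj χ Q := by
    intro Q hQ h
    refine hWv (Q.map P.subtype) (lt_of_le_of_ne (Subgroup.map_subtype_le Q) fun heq => ?_)
      (relProj_lift haX hqX htX h)
    refine hQ.ne (eq_top_iff.2 fun u _ => ?_)
    have hu : (u : G) ∈ Q.map P.subtype := by rw [heq]; exact u.2
    obtain ⟨v, hv, hvu⟩ := hu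
    have : v = u := Subtype.ext hvu
    rwa [← this]
  obtain ⟨g, hg, hgb⟩ := conj_iso hX hXv hiX hqX hqiX hVi hA hB hAB
  obtain ⟨θ, hθ'⟩ : ∃ θ : V' ≃ₗ[k] X, ∀ x, θ x = qX (σ₂ g (A x)) :=
    ⟨LinearEquiv.ofBijective (qX ∘ₗ σ₂ g ∘ₗ A) hgb, fun x => rfl⟩
  have hmove : ∀ (u : ↥P) w, qX (σ₂ g (σ₂ u w)) =
      χ ⟨g * u * g⁻¹, (hg u).1 u.2⟩ (qX (σ₂ g w)) := by
    intro u w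
    have e2 := hqX ⟨g * u * g⁻¹, (hg u).1 u.2⟩ (σ₂ g w)
    rw [← e2]
    congr 1
    change _ = σ₂ (g * u * g⁻¹) (σ₂ g w)
    rw [← rep_mul, ← rep_mul]; simp
  have hθ : ∀ (u : ↥P) x, θ (σV' u x) = χ ⟨g * u * g⁻¹, (hg u).1 u.2⟩ (θ x) := by
    intro u x
    have e1 : A (σV' u x) = σ₂ u (A x) := hA u x
    rw [hθ', hθ', e1, hmove]
  refine ⟨θ.symm.toLinearMap ∘ₗ qX ∘ₗ σ₂ g, A, ?_, fun u => ?_, fun u => ?_⟩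
  · ext x
    change θ.symm (qX (σ₂ g (A x))) = x
    rw [← hθ', θ.symm_apply_apply]
  · ext w
    change θ.symm (qX (σ₂ g (σ₂ u w))) = σV' u (θ.symm (qX (σ₂ g w)))
    rw [hmove]
    apply θ.injective
    rw [hθ, θ.apply_symm_apply, θ.apply_symm_apply]
  · ext x
    exact (hA u x).symm

end Helpers

/-- Let `k ⊆ k'` be a field extension (char `k = p`), `G` a finite group,
`M` a finitely generated indecomposable `kG`-module with vertex `P`, `U'` an indecomposable
direct summand of `k' ⊗_k M` and `V'` a `k'P`-source of `U'`.  If `V' ≅ k' ⊗_k V` for some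
`kP`-module `V`, then `V` is a `kP`-source of `M`, and moreover every indecomposable direct
summand of `k' ⊗_k M` has `V'` as a source. -/
theorem stmt15 (k k' : Type*) [Field k] [Field k'] [Algebra k k']
    (p : ℕ) [Fact p.Prime] [CharP k p]
    (G : Type*) [Group G] [Finite G]
    (M : Type*) [AddCommGroup M] [Module k M] [Module.Finite k M]
    (ρ : Representation k G M) (hind : RepIndecomposable ρ)
    (P : Subgroup G) (hvx : IsVertex ρ P)
    -- the scalar extension `k' ⊗ M` of `M`
    (ρ' : Representation k' G (k' ⊗[k] M))
    (hcompat : ∀ (g : G) (c : k') (m : M), ρ' g (c ⊗ₜ[k] m) = c ⊗ₜ[k] (ρ g m))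
    -- `U'`, an indecomposable direct summand of `k' ⊗ M`
    (U' : Type*) [AddCommGroup U'] [Module k' U']
    (σ : Representation k' G U') (hU'summand : IsRepSummand ρ' σ)
    (hU'ind : RepIndecomposable σ)
    -- `V'`, a `k'P`-source of `U'`
    (V' : Type*) [AddCommGroup V'] [Module k' V']
    (σV' : Representation k' ↥P V') (hsource : IsSource σ P σV')
    -- assume `V' ≅ k' ⊗ V` for a `kP`-module `V`
    (V : Type*) [AddCommGroup V] [Module k V] [Module.Finite k V]
    (τ : Representation k ↥P V)
    (τ' : Representation k' ↥P (k' ⊗[k] V))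
    (hτcompat : ∀ (u : ↥P) (c : k') (v : V), τ' u (c ⊗ₜ[k] v) = c ⊗ₜ[k] (τ u v))
    (e : (k' ⊗[k] V) ≃ₗ[k'] V')
    (hequiv : ∀ (u : ↥P) (x : k' ⊗[k] V), e (τ' u x) = σV' u (e x)) :
    -- then `V` is a `kP`-source of `M` …
    IsSource ρ P τ ∧
    -- … and every indecomposable direct summand of `k' ⊗ M` has `V'` as a source
    ∀ (W : Type) [AddCommGroup W] [Module k' W] (σ₂ : Representation k' G W),
      IsRepSummand ρ' σ₂ → RepIndecomposable σ₂ → IsSource σ₂ P σV' := by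

  have hρ : Compat ρ ρ' := fun g => by ext m; simp [hcompat]
  have hτ : Compat τ τ' := fun g => by ext m; simp [hτcompat]
  have he : Eqv τ' σV' e.toLinearMap := fun u x => hequiv u x
  obtain ⟨πU, ιU, hU1, hU2, hU3⟩ := hU'summand
  obtain ⟨hVi, hVv, πV, ιV, hV1, hV2, hV3⟩ := hsource
  have hτ'i : RepIndecomposable τ' := indec_equiv e he hVi
  have hτi : RepIndecomposable τ := bc_indec hτ hτ'i
  have hτ'v : ∀ Q : Subgroup ↥P, Q < ⊤ → ¬ RelProj τ' Q := fun Q hQ h =>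
    hVv.2 Q hQ (relProj_summand he he.symm (by ext x; simp) h)
  have hτv : ∀ Q : Subgroup ↥P, Q < ⊤ → ¬ RelProj τ Q := fun Q hQ h =>
    hτ'v Q hQ (relProj_bc hτ h)
  have hU2' : ∀ g x, πU (ρ' g x) = σ g (πU x) := fun g x => LinearMap.congr_fun (hU2 g) x
  have hU3' : ∀ g x, ιU (σ g x) = ρ' g (ιU x) := fun g x => (LinearMap.congr_fun (hU3 g) x).symm
  have hV2' : ∀ (g : ↥P) x, πV (σ g x) = σV' g (πV x) := fun g x => LinearMap.congr_fun (hV2 g) x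
  have hV3' : ∀ (g : ↥P) x, ιV (σV' g x) = σ g (ιV x) :=
    fun g x => (LinearMap.congr_fun (hV3 g) x).symm
  have hU1' : ∀ x, πU (ιU x) = x := LinearMap.congr_fun hU1
  have hV1' : ∀ x, πV (ιV x) = x := LinearMap.congr_fun hV1
  -- `V` is a summand of the restriction of `M`
  obtain ⟨q, i, hq, hi, hqi⟩ := summand_descent (ρ := resP ρ P) (ρ' := resP ρ' P) (τ := τ)
    (τ' := τ') (fun g => hρ g) hτ hτi
    (π := e.symm.toLinearMap ∘ₗ πV ∘ₗ πU) (ι := ιU ∘ₗ ιV ∘ₗ e.toLinearMap)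
    (he.symm.comp (σ := σV') (Eqv.comp (σ := resP σ P) (fun u x => hV2' u x) fun u x => hU2' u x))
    (Eqv.comp (σ := resP σ P) (fun u x => hU3' u x) (Eqv.comp (σ := σV') (fun u x => hV3' u x) he))
    (by ext x; simp [hU1', hV1'])
  refine ⟨⟨hτi, ⟨relProj_top τ, hτv⟩, q, i, hqi, fun g => ?_, fun g => ?_⟩, ?_⟩
  · ext x; exact hq g x
  · ext x; exact (hi g x).symm
  -- `M` is a summand of the module induced from `V`
  obtain ⟨a, b, ha, hb, hab⟩ := ind_from_source hind hvx.1 hτi hτv hq hi hqi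
  intro W _ _ σ₂ hWs hWi
  refine ⟨hVi, hVv, ?_⟩
  obtain ⟨πW, ιW, hW1, hW2, hW3⟩ := hWs
  have hW2' : Eqv ρ' σ₂ πW := fun g x => LinearMap.congr_fun (hW2 g) x
  have hW3' : Eqv σ₂ ρ' ιW := fun g x => (LinearMap.congr_fun (hW3 g) x).symm
  have hWfin : Module.Finite k' W := by
    refine Module.Finite.of_surjective πW fun w => ⟨ιW w, LinearMap.congr_fun hW1 w⟩
  have hWv : ∀ Q : Subgroup G, Q < P → ¬ RelProj σ₂ Q := fun Q hQ h =>
    hvx.2 Q hQ (vertex_descent hρ hind hWi.1 hW2' hW3' hW1 h)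
  have hWP : RelProj σ₂ P := relProj_summand hW2' hW3' hW1 (relProj_bc hρ hvx.1)
  have hρP : Compat (resP ρ P) (resP ρ' P) := fun g => hρ g
  have hW2P : Eqv (resP ρ' P) (resP σ₂ P) πW := fun u x => hW2' u x
  have hW3P : Eqv (resP σ₂ P) (resP ρ' P) ιW := fun u x => hW3' u x
  have ha' : Eqv τ' (resP ρ' P) (a.baseChange k') := bc_eqv hτ hρP ha
  have hb' : Eqv (resP ρ' P) τ' (b.baseChange k') := bc_eqv hρP hτ hb
  have hA : Eqv σV' (resP σ₂ P) (πW ∘ₗ a.baseChange k' ∘ₗ e.symm.toLinearMap) :=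
    hW2P.comp (ha'.comp he.symm)
  have hB : Eqv (resP σ₂ P) σV' (e.toLinearMap ∘ₗ b.baseChange k' ∘ₗ ιW) :=
    he.comp (hb'.comp hW3P)
  refine source_of_ind hWi hWP hWv hVi hA hB ?_
  have h1 : (πW ∘ₗ a.baseChange k' ∘ₗ e.symm.toLinearMap) ∘ₗ
      (e.toLinearMap ∘ₗ b.baseChange k' ∘ₗ ιW) = πW ∘ₗ (a ∘ₗ b).baseChange k' ∘ₗ ιW := by
    refine LinearMap.ext fun x => ?_
    simp [LinearMap.baseChange_comp]
  rw [h1, trG_natural P hW2' hW3', trG_bc hρ, hab, LinearMap.baseChange_id, LinearMap.id_comp, hW1]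
end
end
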